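/- arXiv:2412.01995 — 3 statements merged into one kernel-verified Lean document; each statement's English description precedes it below -/
import Mathlib

section
/- Let g be a C^∞ function on Δ with everywhere positive definite Hessian satisfying g(x) = log det(½∇²g(x)) for all x ∈ Δ and g(x) → +∞ as x approaches any boundary point of Δ. Fix x⁰ ∈ ∂Δ with x⁰_1 = ⋯ = x⁰_k = 0 (for some 1 ≤ k ≤ d), x⁰_{k+1}, …, x⁰_d > 0, and ∑_{j=k+1}^d x⁰_j < 1, and set r := (1 − ∑_{j=k+1}^d x⁰_j)/(2d). Then there exist positive constants c₁, c₂ (depending only on x⁰) such that for all x_1, …, x_k ∈ (0, r), in the Loewner order of symmetric matrices, c₁·Diag(1/x_1², …, 1/x_k², 1, …, 1) ≤ ∇²g(x_1, …, x_k, x⁰_{k+1}, …, x⁰_d) ≤ c₂·Diag(1/x_1², …, 1/x_k², 1, …, 1). -/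
open Real Filter MeasureTheory
open scoped Matrix

noncomputable section

/-- The open subprobability simplex in `ℝ^d`. -/
def simplexΔ (d : ℕ) : Set (Fin d → ℝ) := {x | (∀ i, 0 < x i) ∧ ∑ i, x i < 1}

/-- Hessian matrix of `u` at `x` (entries `∂²u/∂xᵢ∂xⱼ`). -/
def hess (d : ℕ) (u : (Fin d → ℝ) → ℝ) (x : Fin d → ℝ) : Matrix (Fin d) (Fin d) ℝ :=
  Matrix.of fun i j => fderiv ℝ (fun y => fderiv ℝ u y (Pi.single j 1)) x (Pi.single i 1)

/-- The barrier function `w(x) = -2∑ log xᵢ - 2 log(1-∑xᵢ)`. -/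
def wbar (d : ℕ) (x : Fin d → ℝ) : ℝ :=
  -2 * ∑ i, Real.log (x i) - 2 * Real.log (1 - ∑ i, x i)

/-- Gradient of `u` at `x`. -/
def gradv (d : ℕ) (u : (Fin d → ℝ) → ℝ) (x : Fin d → ℝ) : Fin d → ℝ :=
  fun i => fderiv ℝ u x (Pi.single i 1)

/-- The derivative of `f` in the direction `v`, as a function of the base point. -/
def dirDeriv {E : Type*} [NormedAddCommGroup E] [NormedSpace ℝ E] (v : E) (f : E → ℝ) : E → ℝ :=
  fun y => fderiv ℝ f y v

section DirDeriv

variable {E : Type*} [NormedAddCommGroup E] [NormedSpace ℝ E] {U : Set E} {f : E → ℝ}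

lemma ContDiffOn.dirDeriv (hU : IsOpen U) (hf : ContDiffOn ℝ (⊤ : ℕ∞) f U) (v : E) :
    ContDiffOn ℝ (⊤ : ℕ∞) (dirDeriv v f) U :=
  (hf.fderiv_of_isOpen hU (m := ((⊤ : ℕ∞) : WithTop ℕ∞)) (by simp)).clm_apply contDiffOn_const

lemma ContDiffOn.differentiableAt_of_mem (hU : IsOpen U) (hf : ContDiffOn ℝ (⊤ : ℕ∞) f U)
    {y : E} (hy : y ∈ U) : DifferentiableAt ℝ f y :=
  (hf.contDiffAt (hU.mem_nhds hy)).differentiableAt (by simp)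

lemma dirDeriv_sum_smul {ι : Type*} (s : Finset ι) (c : ι → ℝ) (v : ι → E) (f : E → ℝ) (y : E) :
    dirDeriv (∑ a ∈ s, c a • v a) f y = ∑ a ∈ s, c a * dirDeriv (v a) f y := by
  simp [dirDeriv, map_sum]

lemma dirDeriv_congr_of_eventuallyEq {f₁ f₂ : E → ℝ} {y : E} (h : f₁ =ᶠ[nhds y] f₂) (v : E) :
    dirDeriv v f₁ y = dirDeriv v f₂ y := by
  simp only [dirDeriv, h.fderiv_eq]

lemma HasFDerivAt.dirDeriv_eq {f' : E →L[ℝ] ℝ} {y : E} (h : HasFDerivAt f f' y) (v : E) :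
    dirDeriv v f y = f' v := by
  simp only [dirDeriv, h.fderiv]

lemma dirDeriv_sum_of_differentiableAt {ι : Type*} (s : Finset ι) (c : ι → ℝ) (φ : ι → E → ℝ)
    {y : E} (h : ∀ a ∈ s, DifferentiableAt ℝ (φ a) y) (v : E) :
    dirDeriv v (fun x => ∑ a ∈ s, c a * φ a x) y = ∑ a ∈ s, c a * dirDeriv v (φ a) y := by
  have := HasFDerivAt.fun_sum (u := s) (A := fun a x => c a * φ a x)
    (fun a ha => ((h a ha).hasFDerivAt.const_mul (c a)))
  rw [this.dirDeriv_eq]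
  simp [dirDeriv]

lemma two_le_smooth : (2 : WithTop ℕ∞) ≤ ((⊤ : ℕ∞) : WithTop ℕ∞) := by
  exact WithTop.coe_le_coe.2 (le_top : (2 : ℕ∞) ≤ ⊤)

lemma dirDeriv_comm (hU : IsOpen U) (hf : ContDiffOn ℝ (⊤ : ℕ∞) f U) (v w : E) {y : E}
    (hy : y ∈ U) : dirDeriv v (dirDeriv w f) y = dirDeriv w (dirDeriv v f) y := by
  have hc := hf.contDiffAt (hU.mem_nhds hy)
  have hs : IsSymmSndFDerivAt ℝ f y := hc.isSymmSndFDerivAt (by simpa using two_le_smooth)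
  have hd : DifferentiableAt ℝ (fderiv ℝ f) y :=
    (hc.fderiv_right (m := 1) (by simpa [one_add_one_eq_two] using two_le_smooth)).differentiableAt (by simp)
  have key : ∀ a b : E, dirDeriv a (dirDeriv b f) y = fderiv ℝ (fderiv ℝ f) y a b := by
    intro a b
    refine ((hd.hasFDerivAt.clm_apply (hasFDerivAt_const b y)).dirDeriv_eq a).trans ?_
    simp
  rw [key, key, hs v w]

lemma hasDerivAt_line {y v : E} {t : ℝ} (h : DifferentiableAt ℝ f (y + t • v)) :
    HasDerivAt (fun s : ℝ => f (y + s • v)) (dirDeriv v f (y + t • v)) t := by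
  have hl : HasDerivAt (fun s : ℝ => y + s • v) v t := by
    simpa using ((hasDerivAt_id t).smul_const v).const_add y
  exact h.hasFDerivAt.comp_hasDerivAt t hl

lemma eventually_line_mem (hU : IsOpen U) {y : E} (hy : y ∈ U) (v : E) :
    ∀ᶠ t : ℝ in nhds 0, y + t • v ∈ U := by
  have hc : ContinuousAt (fun t : ℝ => y + t • v) 0 := by fun_prop
  exact hc.eventually_mem (hU.mem_nhds (by simpa using hy))

lemma dirDeriv_eq_zero_of_isLocalMax {y : E} (h : IsLocalMax f y) (v : E) :
    dirDeriv v f y = 0 := by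
  simp [dirDeriv, h.fderiv_eq_zero]

lemma dirDeriv_dirDeriv_nonpos_of_isLocalMax (hU : IsOpen U)
    (hf : ContDiffOn ℝ (⊤ : ℕ∞) f U) {y : E} (hy : y ∈ U) (h : IsLocalMax f y) (v : E) :
    dirDeriv v (dirDeriv v f) y ≤ 0 := by
  by_contra! hlt
  set φ : ℝ → ℝ := fun t => f (y + t • v)
  have hmem := eventually_line_mem hU hy v
  have hφ : deriv φ =ᶠ[nhds 0] fun t => dirDeriv v f (y + t • v) := by
    filter_upwards [hmem] with t ht
    exact (hasDerivAt_line (hf.differentiableAt_of_mem hU ht)).deriv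
  have hφ2 : deriv (deriv φ) 0 = dirDeriv v (dirDeriv v f) y := by
    rw [hφ.deriv_eq]
    have := (hasDerivAt_line (f := _root_.dirDeriv v f) (y := y) (v := v) (t := 0)
      ((hf.dirDeriv hU v).differentiableAt_of_mem hU (by simpa using hy))).deriv
    simpa using this
  have hlm : IsLocalMax φ 0 := by
    have hc : ContinuousAt (fun t : ℝ => y + t • v) 0 := by fun_prop
    have h' : IsLocalMax f (y + (0 : ℝ) • v) := by simpa using h
    exact hc.eventually (p := fun x => f x ≤ f (y + (0 : ℝ) • v)) h'
  have hmin : IsLocalMin φ 0 := by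
    refine isLocalMin_of_deriv_deriv_pos (hφ2 ▸ hlt) hlm.deriv_eq_zero ?_
    exact (hasDerivAt_line (f := f) (y := y) (v := v) (t := 0)
      (hf.differentiableAt_of_mem hU (by simpa using hy))).continuousAt
  have hconst : φ =ᶠ[nhds 0] fun _ => φ 0 := by
    filter_upwards [hlm, hmin] with t h1 h2 using le_antisymm h1 h2
  have hd0 : deriv φ =ᶠ[nhds 0] fun _ => 0 := by
    filter_upwards [hconst.eventuallyEq_nhds] with t ht
    simp [ht.deriv_eq]
  have : deriv (deriv φ) 0 = 0 := by simp [hd0.deriv_eq]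
  linarith

end DirDeriv

section Determinant

variable {n : Type*} [Fintype n] [DecidableEq n]

lemma hasDerivAt_det {B : ℝ → Matrix n n ℝ} {B' : Matrix n n ℝ} {t : ℝ}
    (hB : ∀ i j, HasDerivAt (fun s => B s i j) (B' i j) t) :
    HasDerivAt (fun s => (B s).det) ((B t).adjugate * B').trace t := by
  have h1 : HasDerivAt (fun s => (B s).det)
      (∑ σ : Equiv.Perm n, ((Equiv.Perm.sign σ : ℤ) : ℝ) *
        ∑ i, (∏ j ∈ Finset.univ.erase i, B t (σ j) j) • B' (σ i) i) t := by
    simp only [Matrix.det_apply']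
    exact HasDerivAt.fun_sum fun σ _ =>
      (HasDerivAt.fun_finsetProd (u := Finset.univ) (fun i _ => hB (σ i) i)).const_mul _
  convert h1 using 1
  have h2 : ((B t).adjugate * B').trace = ∑ i, ((B t).updateCol i (fun k => B' k i)).det := by
    refine Finset.sum_congr rfl fun i _ => ?_
    rw [← Matrix.cramer_apply, Matrix.cramer_eq_adjugate_mulVec]
    rfl
  rw [h2]
  simp only [Matrix.det_apply', Finset.mul_sum]
  rw [Finset.sum_comm]
  refine Finset.sum_congr rfl fun σ _ => Finset.sum_congr rfl fun i _ => ?_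
  congr 1
  rw [← Finset.mul_prod_erase Finset.univ _ (Finset.mem_univ i), smul_eq_mul, mul_comm]
  congr 1
  · refine Finset.prod_congr rfl fun j hj => ?_
    rw [Matrix.updateCol_ne (Finset.ne_of_mem_erase hj)]
  · simp

lemma differentiableAt_adjugate {B : ℝ → Matrix n n ℝ} {t : ℝ}
    (hB : ∀ i j, DifferentiableAt ℝ (fun s => B s i j) t) (i j : n) :
    DifferentiableAt ℝ (fun s => (B s).adjugate i j) t := by
  simp only [Matrix.adjugate_apply]
  refine (hasDerivAt_det (B' := Matrix.of fun k l => deriv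
    (fun s => (B s).updateRow j (Pi.single i 1) k l) t) fun k l => ?_).differentiableAt
  refine DifferentiableAt.hasDerivAt ?_
  by_cases hk : k = j
  · subst hk; simp
  · simpa [Matrix.updateRow_ne hk] using hB k l

/-- Second order expansion of `log det B = u + const` at a point where `B = 1`. -/
lemma trace_eq_of_det_eq_mul_exp {B B₁ : ℝ → Matrix n n ℝ} {B₂ : Matrix n n ℝ} {u u₁ : ℝ → ℝ}
    {u₂ c : ℝ} (hB : ∀ᶠ t in nhds 0, ∀ i j, HasDerivAt (fun s => B s i j) (B₁ t i j) t)
    (hB₁ : ∀ i j, HasDerivAt (fun s => B₁ s i j) (B₂ i j) 0) (hB0 : B 0 = 1)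
    (hu : ∀ᶠ t in nhds 0, HasDerivAt u (u₁ t) t) (hu₁ : HasDerivAt u₁ u₂ 0)
    (hdet : ∀ᶠ t in nhds 0, (B t).det = c * Real.exp (u t)) :
    (B₁ 0).trace = u₁ 0 ∧ B₂.trace = u₂ + (B₁ 0 * B₁ 0).trace := by
  have hfirst : (fun t => ((B t).adjugate * B₁ t).trace) =ᶠ[nhds 0]
      fun t => (B t).det * u₁ t := by
    filter_upwards [hdet.eventually_nhds, hB, hu] with t h1 h2 h3
    have e1 := hasDerivAt_det h2
    have e2 : HasDerivAt (fun s => (B s).det) (c * (Real.exp (u t) * u₁ t)) t :=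
      (h3.exp.const_mul c).congr_of_eventuallyEq h1
    rw [e1.unique e2, h1.self_of_nhds]; ring
  have htr : (B₁ 0).trace = u₁ 0 := by
    have := hfirst.self_of_nhds
    simpa [hB0] using this
  refine ⟨htr, ?_⟩
  have hB' := hB.self_of_nhds
  have hdet' : HasDerivAt (fun s => (B s).det) (B₁ 0).trace 0 := by
    simpa [hB0] using hasDerivAt_det hB'
  set A' : Matrix n n ℝ := Matrix.of fun i j => deriv (fun s => (B s).adjugate i j) 0 with hA'
  have hA : ∀ i j, HasDerivAt (fun s => (B s).adjugate i j) (A' i j) 0 := fun i j =>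
    (differentiableAt_adjugate (fun i j => (hB' i j).differentiableAt) i j).hasDerivAt
  have hA'eq : A' = (B₁ 0).trace • (1 : Matrix n n ℝ) - B₁ 0 := by
    ext i j
    have e1 : HasDerivAt (fun s => ((B s).adjugate * B s) i j)
        (∑ k, (A' i k * B 0 k j + (B 0).adjugate i k * B₁ 0 k j)) 0 := by
      simp only [Matrix.mul_apply]
      exact HasDerivAt.fun_sum fun k _ => (hA i k).mul (hB' k j)
    have e2 : HasDerivAt (fun s => ((B s).adjugate * B s) i j)
        ((B₁ 0).trace * (1 : Matrix n n ℝ) i j) 0 := by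
      simp only [Matrix.adjugate_mul, Matrix.smul_apply, smul_eq_mul]
      exact hdet'.mul_const _
    have e3 := e1.unique e2
    rw [hB0] at e3
    simp only [Matrix.adjugate_one, Finset.sum_add_distrib] at e3
    rw [← Matrix.mul_apply, ← Matrix.mul_apply] at e3
    simp only [Matrix.mul_one, Matrix.one_mul] at e3
    simp only [Matrix.sub_apply, Matrix.smul_apply, smul_eq_mul]
    linarith
  have e1 : HasDerivAt (fun t => ((B t).adjugate * B₁ t).trace)
      (∑ i, ∑ k, (A' i k * B₁ 0 k i + (B 0).adjugate i k * B₂ k i)) 0 := by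
    simp only [Matrix.trace, Matrix.diag, Matrix.mul_apply]
    exact HasDerivAt.fun_sum fun i _ => HasDerivAt.fun_sum fun k _ => (hA i k).mul (hB₁ k i)
  have e2 := (hdet'.mul hu₁).congr_of_eventuallyEq hfirst
  have e3 := e1.unique e2
  have e4 : (∑ i, ∑ k, (A' i k * B₁ 0 k i + (B 0).adjugate i k * B₂ k i))
      = (A' * B₁ 0).trace + ((B 0).adjugate * B₂).trace := by
    simp only [Matrix.trace, Matrix.diag, Matrix.mul_apply, Finset.sum_add_distrib]
  rw [e4, hB0, hA'eq] at e3
  simp only [Matrix.adjugate_one, Matrix.one_mul, Matrix.sub_mul, Matrix.smul_mul,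
    Matrix.trace_sub, Matrix.trace_smul, smul_eq_mul, Matrix.det_one] at e3
  rw [htr] at e3
  linarith

end Determinant

section Composition

variable {E : Type*} [NormedAddCommGroup E] [NormedSpace ℝ E] {U : Set E} {f h : E → ℝ}

lemma dirDeriv_dirDeriv_add (hU : IsOpen U) (hf : ContDiffOn ℝ (⊤ : ℕ∞) f U)
    (hh : ContDiffOn ℝ (⊤ : ℕ∞) h U) {y : E} (hy : y ∈ U) (v : E) :
    dirDeriv v (dirDeriv v fun x => f x + h x) y
      = dirDeriv v (dirDeriv v f) y + dirDeriv v (dirDeriv v h) y := by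
  have e1 : dirDeriv v (fun x => f x + h x) =ᶠ[nhds y]
      fun x => dirDeriv v f x + dirDeriv v h x := by
    filter_upwards [hU.mem_nhds hy] with x hx
    exact ((hf.differentiableAt_of_mem hU hx).hasFDerivAt.add
      (hh.differentiableAt_of_mem hU hx).hasFDerivAt).dirDeriv_eq v
  rw [dirDeriv_congr_of_eventuallyEq e1]
  exact (((hf.dirDeriv hU v).differentiableAt_of_mem hU hy).hasFDerivAt.add
      ((hh.dirDeriv hU v).differentiableAt_of_mem hU hy).hasFDerivAt).dirDeriv_eq v

lemma dirDeriv_add (hU : IsOpen U) (hf : ContDiffOn ℝ (⊤ : ℕ∞) f U)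
    (hh : ContDiffOn ℝ (⊤ : ℕ∞) h U) {y : E} (hy : y ∈ U) (v : E) :
    dirDeriv v (fun x => f x + h x) y = dirDeriv v f y + dirDeriv v h y :=
  ((hf.differentiableAt_of_mem hU hy).hasFDerivAt.add
    (hh.differentiableAt_of_mem hU hy).hasFDerivAt).dirDeriv_eq v

lemma dirDeriv_log {y : E} (hf : DifferentiableAt ℝ f y) (h0 : f y ≠ 0) (v : E) :
    dirDeriv v (fun x => Real.log (f x)) y = (f y)⁻¹ * dirDeriv v f y := by
  simpa [dirDeriv] using (hf.hasFDerivAt.log h0).dirDeriv_eq v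

lemma dirDeriv_dirDeriv_log (hU : IsOpen U) (hf : ContDiffOn ℝ (⊤ : ℕ∞) f U)
    (h0 : ∀ x ∈ U, f x ≠ 0) {y : E} (hy : y ∈ U) (v w : E) :
    dirDeriv w (dirDeriv v fun x => Real.log (f x)) y
      = dirDeriv w (dirDeriv v f) y / f y - dirDeriv w f y * dirDeriv v f y / f y ^ 2 := by
  have e1 : dirDeriv v (fun x => Real.log (f x)) =ᶠ[nhds y]
      fun x => (f x)⁻¹ * dirDeriv v f x := by
    filter_upwards [hU.mem_nhds hy] with x hx
    exact dirDeriv_log (hf.differentiableAt_of_mem hU hx) (h0 x hx) v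
  rw [dirDeriv_congr_of_eventuallyEq e1]
  have d1 := (hf.differentiableAt_of_mem hU hy).hasFDerivAt
  have d2 := ((hf.dirDeriv hU v).differentiableAt_of_mem hU hy).hasFDerivAt
  have d3 := (hasDerivAt_inv (h0 y hy)).comp_hasFDerivAt y d1
  refine ((d3.mul d2).dirDeriv_eq w).trans ?_
  have := h0 y hy
  simp only [Function.comp_apply, dirDeriv, neg_smul, smul_neg, add_apply,
    smul_apply, smul_eq_mul, neg_apply]
  field_simp
  ring

lemma dirDeriv_half_sq {y : E} (hf : DifferentiableAt ℝ f y) (v : E) :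
    dirDeriv v (fun x => f x ^ 2 / 2) y = f y * dirDeriv v f y := by
  refine (((hf.hasFDerivAt.pow 2).mul_const (2⁻¹ : ℝ)).dirDeriv_eq v).trans ?_
  simp [dirDeriv]
  ring

lemma dirDeriv_dirDeriv_half_sq (hU : IsOpen U) (hf : ContDiffOn ℝ (⊤ : ℕ∞) f U)
    {y : E} (hy : y ∈ U) (v : E) :
    dirDeriv v (dirDeriv v fun x => f x ^ 2 / 2) y
      = dirDeriv v f y ^ 2 + f y * dirDeriv v (dirDeriv v f) y := by
  have e1 : dirDeriv v (fun x => f x ^ 2 / 2) =ᶠ[nhds y] fun x => f x * dirDeriv v f x := by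
    filter_upwards [hU.mem_nhds hy] with x hx
    exact dirDeriv_half_sq (hf.differentiableAt_of_mem hU hx) v
  rw [dirDeriv_congr_of_eventuallyEq e1]
  refine (((hf.differentiableAt_of_mem hU hy).hasFDerivAt.mul
    ((hf.dirDeriv hU v).differentiableAt_of_mem hU hy).hasFDerivAt).dirDeriv_eq v).trans ?_
  simp [dirDeriv]
  ring

end Composition

section Hessian

variable {d : ℕ} {U : Set (Fin d → ℝ)} {g : (Fin d → ℝ) → ℝ}

lemma dirDeriv_eq_sum (w : Fin d → ℝ) (f : (Fin d → ℝ) → ℝ) (y : Fin d → ℝ) :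
    dirDeriv w f y = ∑ j, w j * dirDeriv (Pi.single j 1) f y := by
  conv_lhs => rw [pi_eq_sum_univ' w]
  exact dirDeriv_sum_smul _ _ _ _ _

lemma dirDeriv_dirDeriv_eq_sum_hess (hU : IsOpen U) (hg : ContDiffOn ℝ (⊤ : ℕ∞) g U)
    {y : Fin d → ℝ} (hy : y ∈ U) (v w : Fin d → ℝ) :
    dirDeriv v (dirDeriv w g) y = ∑ i, ∑ j, v i * hess d g y i j * w j := by
  rw [dirDeriv_eq_sum v]
  refine Finset.sum_congr rfl fun i _ => ?_
  have : dirDeriv w g = fun x => ∑ j, w j * dirDeriv (Pi.single j 1) g x := by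
    funext x; exact dirDeriv_eq_sum w g x
  rw [this, dirDeriv_sum_of_differentiableAt _ _ _
    (fun j _ => (hg.dirDeriv hU _).differentiableAt_of_mem hU hy), Finset.mul_sum]
  refine Finset.sum_congr rfl fun j _ => ?_
  have hij : hess d g y i j = dirDeriv (Pi.single i 1) (dirDeriv (Pi.single j 1) g) y := rfl
  rw [hij]
  ring

lemma dirDeriv_dirDeriv_eq_dotProduct (hU : IsOpen U) (hg : ContDiffOn ℝ (⊤ : ℕ∞) g U)
    {y : Fin d → ℝ} (hy : y ∈ U) (v w : Fin d → ℝ) :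
    dirDeriv v (dirDeriv w g) y = v ⬝ᵥ (hess d g y *ᵥ w) := by
  rw [dirDeriv_dirDeriv_eq_sum_hess hU hg hy]
  simp only [dotProduct, Matrix.mulVec, Finset.mul_sum, mul_assoc]

lemma Matrix.PosDef.exists_isUnit_transpose_mul_mul_eq_one {n : Type*} [Fintype n] [DecidableEq n]
    {H : Matrix n n ℝ} (hH : H.PosDef) :
    ∃ P Q : Matrix n n ℝ, Pᵀ * H * P = 1 ∧ P * Q = 1 := by
  open scoped MatrixOrder in
  obtain ⟨B, hB⟩ := CStarAlgebra.nonneg_iff_eq_star_mul_self.1 hH.posSemidef.nonneg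
  have hBu : IsUnit B.det := by
    have := (Matrix.isUnit_iff_isUnit_det _).1 hH.isUnit
    rw [hB, Matrix.det_mul] at this
    exact isUnit_of_mul_isUnit_right this
  refine ⟨B⁻¹, B, ?_, Matrix.nonsing_inv_mul _ hBu⟩
  have hs : star B = Bᵀ := by
    ext i j; simp [Matrix.star_apply]
  rw [hB, hs, Matrix.mul_assoc, Matrix.mul_assoc, Matrix.mul_nonsing_inv _ hBu, Matrix.mul_one,
    ← Matrix.transpose_mul, Matrix.mul_nonsing_inv _ hBu, Matrix.transpose_one]

/-- Differentiating `det ∇²g = c exp g` twice in the direction `e`, in a frame that is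
orthonormal for `∇²g` at the point. -/
lemma sum_dirDeriv_of_det_hess_eq (hU : IsOpen U) (hg : ContDiffOn ℝ (⊤ : ℕ∞) g U) {c : ℝ}
    (hdet : ∀ y ∈ U, (hess d g y).det = c * Real.exp (g y)) {z : Fin d → ℝ} (hz : z ∈ U)
    (P : Matrix (Fin d) (Fin d) ℝ) (hP : Pᵀ * hess d g z * P = 1) (e : Fin d → ℝ) :
    ∑ a, dirDeriv e (dirDeriv (P.col a) (dirDeriv (P.col a) g)) z = dirDeriv e g z ∧
    ∑ a, dirDeriv e (dirDeriv e (dirDeriv (P.col a) (dirDeriv (P.col a) g))) z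
      = dirDeriv e (dirDeriv e g) z
        + ∑ a, ∑ b, dirDeriv e (dirDeriv (P.col a) (dirDeriv (P.col b) g)) z ^ 2 := by
  have hmem := eventually_line_mem hU hz e
  have hsm : ∀ a b, ContDiffOn ℝ (⊤ : ℕ∞) (dirDeriv (P.col a) (dirDeriv (P.col b) g)) U :=
    fun a b => (hg.dirDeriv hU _).dirDeriv hU _
  have hBeq : ∀ y ∈ U, Matrix.of (fun a b => dirDeriv (P.col a) (dirDeriv (P.col b) g) y)
      = Pᵀ * hess d g y * P := by
    intro y hy
    ext a b
    rw [Matrix.of_apply, dirDeriv_dirDeriv_eq_sum_hess hU hg hy]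
    simp only [Matrix.mul_apply, Matrix.transpose_apply, Matrix.col_apply, Finset.sum_mul]
    rw [Finset.sum_comm]
  have hz0 : z + (0 : ℝ) • e = z := by simp
  have key := trace_eq_of_det_eq_mul_exp
    (B := fun t => Matrix.of fun a b => dirDeriv (P.col a) (dirDeriv (P.col b) g) (z + t • e))
    (B₁ := fun t => Matrix.of fun a b =>
      dirDeriv e (dirDeriv (P.col a) (dirDeriv (P.col b) g)) (z + t • e))
    (B₂ := Matrix.of fun a b =>
      dirDeriv e (dirDeriv e (dirDeriv (P.col a) (dirDeriv (P.col b) g))) z)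
    (u := fun t => g (z + t • e)) (u₁ := fun t => dirDeriv e g (z + t • e))
    (u₂ := dirDeriv e (dirDeriv e g) z) (c := P.det * P.det * c) ?_ ?_ ?_ ?_ ?_ ?_
  · obtain ⟨k1, k2⟩ := key
    simp only [hz0] at k1 k2
    refine ⟨by simpa [Matrix.trace] using k1, ?_⟩
    simp only [Matrix.trace, Matrix.diag, Matrix.of_apply, Matrix.mul_apply] at k2
    rw [k2]
    congr 1
    refine Finset.sum_congr rfl fun a _ => Finset.sum_congr rfl fun b _ => ?_
    have hcomm : dirDeriv (P.col b) (dirDeriv (P.col a) g) =ᶠ[nhds z]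
        dirDeriv (P.col a) (dirDeriv (P.col b) g) := by
      filter_upwards [hU.mem_nhds hz] with y hy using dirDeriv_comm hU hg _ _ hy
    rw [dirDeriv_congr_of_eventuallyEq hcomm, sq]
  · filter_upwards [hmem] with t ht a b
    exact hasDerivAt_line ((hsm a b).differentiableAt_of_mem hU ht)
  · intro a b
    have := hasDerivAt_line (y := z) (v := e) (t := 0)
      (((hsm a b).dirDeriv hU e).differentiableAt_of_mem hU (by simpa using hz))
    simpa only [hz0, Matrix.of_apply] using this
  · rw [← hP, ← hBeq z hz, hz0]
  · filter_upwards [hmem] with t ht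
    exact hasDerivAt_line (hg.differentiableAt_of_mem hU ht)
  · have := hasDerivAt_line (y := z) (v := e) (t := 0)
      ((hg.dirDeriv hU e).differentiableAt_of_mem hU (by simpa using hz))
    simpa only [hz0] using this
  · filter_upwards [hmem] with t ht
    rw [hBeq _ ht, Matrix.det_mul, Matrix.det_mul, Matrix.det_transpose, hdet _ ht]
    ring

end Hessian

section Pogorelov

/-- A symmetric matrix dominates its first row and column in an orthonormal frame starting
with `ε / |ε|`. -/
lemma two_mul_sum_sq_le_of_symm {n : Type*} [Fintype n] {M : n → n → ℝ}
    (hM : ∀ a b, M a b = M b a) {ε m : n → ℝ} (hm : ∀ a, m a = ∑ b, ε b * M a b)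
    {E : ℝ} (hE : E = ∑ a, ε a ^ 2) (hE0 : 0 < E) :
    2 * (∑ a, m a ^ 2) / E - (∑ a, ε a * m a) ^ 2 / E ^ 2 ≤ ∑ a, ∑ b, M a b ^ 2 := by
  set s := ∑ a, ε a * m a with hs
  have h0 : 0 ≤ ∑ a, ∑ b, (M a b - (ε a * m b + m a * ε b) / E + s * ε a * ε b / E ^ 2) ^ 2 :=
    Finset.sum_nonneg fun a _ => Finset.sum_nonneg fun b _ => sq_nonneg _
  have i1 : ∑ a, ∑ b, ε a ^ 2 * m b ^ 2 = E * ∑ a, m a ^ 2 := by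
    rw [hE, Finset.sum_mul_sum]
  have i2 : ∑ a, ∑ b, m a ^ 2 * ε b ^ 2 = E * ∑ a, m a ^ 2 := by
    rw [hE, mul_comm, Finset.sum_mul_sum]
  have i3 : ∑ a, ∑ b, (ε a * m a) * (ε b * m b) = s * s := by
    rw [hs, Finset.sum_mul_sum]
  have i4 : ∑ a, ∑ b, ε a ^ 2 * ε b ^ 2 = E * E := by
    rw [hE, Finset.sum_mul_sum]
  have i5 : ∑ a, ∑ b, m a * (ε b * M a b) = ∑ a, m a ^ 2 := by
    refine Finset.sum_congr rfl fun a _ => ?_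
    rw [← Finset.mul_sum, ← hm]; ring
  have i6 : ∑ a, ∑ b, m b * (ε a * M a b) = ∑ a, m a ^ 2 := by
    rw [← i5, Finset.sum_comm]
    exact Finset.sum_congr rfl fun a _ => Finset.sum_congr rfl fun b _ => by rw [hM]
  have i7 : ∑ a, ∑ b, ε a * (ε b * M a b) = s := by
    refine Finset.sum_congr rfl fun a _ => ?_
    rw [← Finset.mul_sum, ← hm]
  have i8 : ∑ a, ∑ b, ε a ^ 2 * (ε b * m b) = E * s := by
    rw [hE, hs, Finset.sum_mul_sum]
  have i9 : ∑ a, ∑ b, (ε a * m a) * ε b ^ 2 = E * s := by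
    rw [hE, hs, mul_comm, Finset.sum_mul_sum]
  have expand : ∑ a, ∑ b, (M a b - (ε a * m b + m a * ε b) / E + s * ε a * ε b / E ^ 2) ^ 2
      = (∑ a, ∑ b, M a b ^ 2) + (1 / E ^ 2) * (∑ a, ∑ b, ε a ^ 2 * m b ^ 2)
        + (1 / E ^ 2) * (∑ a, ∑ b, m a ^ 2 * ε b ^ 2)
        + (2 / E ^ 2) * (∑ a, ∑ b, (ε a * m a) * (ε b * m b))
        + (s ^ 2 / E ^ 4) * (∑ a, ∑ b, ε a ^ 2 * ε b ^ 2)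
        + (-2 / E) * (∑ a, ∑ b, m a * (ε b * M a b))
        + (-2 / E) * (∑ a, ∑ b, m b * (ε a * M a b))
        + (2 * s / E ^ 2) * (∑ a, ∑ b, ε a * (ε b * M a b))
        + (-2 * s / E ^ 3) * (∑ a, ∑ b, ε a ^ 2 * (ε b * m b))
        + (-2 * s / E ^ 3) * (∑ a, ∑ b, (ε a * m a) * ε b ^ 2) := by
    simp only [Finset.mul_sum, ← Finset.sum_add_distrib]
    refine Finset.sum_congr rfl fun a _ => Finset.sum_congr rfl fun b _ => ?_
    field_simp
    ring
  rw [expand, i1, i2, i3, i4, i5, i6, i7, i8, i9] at h0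
  have hred : ∀ S T : ℝ, T + 1 / E ^ 2 * (E * S) + 1 / E ^ 2 * (E * S) + 2 / E ^ 2 * (s * s)
      + s ^ 2 / E ^ 4 * (E * E) + -2 / E * S + -2 / E * S + 2 * s / E ^ 2 * s
      + -2 * s / E ^ 3 * (E * s) + -2 * s / E ^ 3 * (E * s)
      = T - (2 * S / E - s ^ 2 / E ^ 2) := by
    intro S T
    field_simp
    ring
  rw [hred] at h0
  linarith

lemma dirDeriv_comm_three {E : Type*} [NormedAddCommGroup E] [NormedSpace ℝ E] {U : Set E}
    {f : E → ℝ} (hU : IsOpen U) (hf : ContDiffOn ℝ (⊤ : ℕ∞) f U) (v e : E) {y : E}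
    (hy : y ∈ U) :
    dirDeriv e (dirDeriv v (dirDeriv v f)) y = dirDeriv v (dirDeriv v (dirDeriv e f)) y := by
  rw [dirDeriv_comm hU (hf.dirDeriv hU v) e v hy]
  refine dirDeriv_congr_of_eventuallyEq ?_ v
  filter_upwards [hU.mem_nhds hy] with x hx using dirDeriv_comm hU hf e v hx

variable {d : ℕ} {U : Set (Fin d → ℝ)} {g η : (Fin d → ℝ) → ℝ}

/-- Pogorelov's estimate at an interior maximum of `log g_ee + log η + g_e² / 2`. -/
lemma dirDeriv_dirDeriv_le_of_isLocalMax (hU : IsOpen U) (hg : ContDiffOn ℝ (⊤ : ℕ∞) g U) {c : ℝ}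
    (hdet : ∀ y ∈ U, (hess d g y).det = c * Real.exp (g y)) {z : Fin d → ℝ} (hz : z ∈ U)
    (hpos : (hess d g z).PosDef) (hη : ContDiffOn ℝ (⊤ : ℕ∞) η U) (hη0 : ∀ y ∈ U, 0 < η y)
    (hηg : ∀ v, dirDeriv v (dirDeriv v η) z = -dirDeriv v (dirDeriv v g) z)
    {e : Fin d → ℝ} (he : ∀ y ∈ U, 0 < dirDeriv e (dirDeriv e g) y)
    (hmax : IsLocalMax (fun y => Real.log (dirDeriv e (dirDeriv e g) y) + Real.log (η y)
      + dirDeriv e g y ^ 2 / 2) z) :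
    dirDeriv e (dirDeriv e g) z
      ≤ d / η z + dirDeriv e η z ^ 2 / (dirDeriv e (dirDeriv e g) z * η z ^ 2) := by
  obtain ⟨P, Q, hP, hPQ⟩ := hpos.exists_isUnit_transpose_mul_mul_eq_one
  set ε : Fin d → ℝ := Q *ᵥ e with hε
  have he_sum : e = ∑ a, ε a • P.col a := by
    have : e = P *ᵥ ε := by rw [hε, Matrix.mulVec_mulVec, hPQ, Matrix.one_mulVec]
    conv_lhs => rw [this]
    funext i
    simp [Matrix.mulVec, dotProduct, mul_comm]
  have hge := hg.dirDeriv hU e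
  have hgee := hge.dirDeriv hU e
  set γ := dirDeriv e g z with hγ
  set E := dirDeriv e (dirDeriv e g) z with hEdef
  set h := η z with hh
  have hE0 : 0 < E := he z hz
  have hh0 : 0 < h := hη0 z hz
  set M : Fin d → Fin d → ℝ :=
    fun a b => dirDeriv e (dirDeriv (P.col a) (dirDeriv (P.col b) g)) z with hMdef
  set m : Fin d → ℝ := fun a => dirDeriv (P.col a) (dirDeriv e (dirDeriv e g)) z with hmdef
  set q : Fin d → ℝ := fun a => dirDeriv (P.col a) η z with hqdef
  have hcol : ∀ a b, dirDeriv (P.col a) (dirDeriv (P.col b) g) z = (1 : Matrix _ _ ℝ) a b := by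
    intro a b
    rw [← hP, dirDeriv_dirDeriv_eq_sum_hess hU hg hz]
    simp only [Matrix.mul_apply, Matrix.transpose_apply, Matrix.col_apply, Finset.sum_mul]
    rw [Finset.sum_comm]
  have hde : ∀ f x, dirDeriv e f x = ∑ b, ε b * dirDeriv (P.col b) f x := by
    intro f x
    conv_lhs => rw [he_sum]
    exact dirDeriv_sum_smul _ _ _ _ _
  have hae : ∀ a, ∀ x ∈ U, dirDeriv (P.col a) (dirDeriv e g) x
      = ∑ b, ε b * dirDeriv (P.col a) (dirDeriv (P.col b) g) x := by
    intro a x hx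
    rw [show dirDeriv e g = fun x => ∑ b, ε b * dirDeriv (P.col b) g x from funext (hde g)]
    exact dirDeriv_sum_of_differentiableAt _ _ _
      (fun j _ => (hg.dirDeriv hU _).differentiableAt_of_mem hU hx) _
  have hεa : ∀ a, dirDeriv (P.col a) (dirDeriv e g) z = ε a := by
    intro a
    rw [hae a z hz]
    simp [hcol, Matrix.one_apply]
  have hEsum : E = ∑ a, ε a ^ 2 := by
    rw [hEdef, hde]
    exact Finset.sum_congr rfl fun a _ => by rw [hεa, sq]
  have hMsymm : ∀ a b, M a b = M b a := by
    intro a b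
    refine dirDeriv_congr_of_eventuallyEq ?_ e
    filter_upwards [hU.mem_nhds hz] with y hy using dirDeriv_comm hU hg _ _ hy
  have hm : ∀ a, m a = ∑ b, ε b * M a b := by
    intro a
    rw [hmdef]
    simp only
    rw [dirDeriv_comm hU hge _ _ hz]
    have : dirDeriv (P.col a) (dirDeriv e g) =ᶠ[nhds z]
        fun x => ∑ b, ε b * dirDeriv (P.col a) (dirDeriv (P.col b) g) x := by
      filter_upwards [hU.mem_nhds hz] with x hx using hae a x hx
    rw [dirDeriv_congr_of_eventuallyEq this]
    exact dirDeriv_sum_of_differentiableAt _ _ _ (fun j _ =>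
      ((hg.dirDeriv hU _).dirDeriv hU _).differentiableAt_of_mem hU hz) _
  obtain ⟨t1, t2⟩ := sum_dirDeriv_of_det_hess_eq hU hg hdet hz P hP e
  have s1 : ContDiffOn ℝ (⊤ : ℕ∞) (fun y => Real.log (dirDeriv e (dirDeriv e g) y)) U :=
    hgee.log fun y hy => (he y hy).ne'
  have s2 : ContDiffOn ℝ (⊤ : ℕ∞) (fun y => Real.log (η y)) U :=
    hη.log fun y hy => (hη0 y hy).ne'
  have s3 : ContDiffOn ℝ (⊤ : ℕ∞) (fun y => dirDeriv e g y ^ 2 / 2) U :=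
    (hge.pow 2).div_const 2
  have crit : ∀ a, q a / h = -(m a / E + γ * ε a) := by
    intro a
    have := dirDeriv_eq_zero_of_isLocalMax hmax (P.col a)
    rw [dirDeriv_add hU (s1.add s2) s3 hz, dirDeriv_add hU s1 s2 hz,
      dirDeriv_log (hgee.differentiableAt_of_mem hU hz) hE0.ne',
      dirDeriv_log (hη.differentiableAt_of_mem hU hz) hh0.ne',
      dirDeriv_half_sq (hge.differentiableAt_of_mem hU hz), hεa] at this
    have e1 : q a / h = h⁻¹ * q a := by rw [div_eq_inv_mul]
    have e2 : m a / E = E⁻¹ * m a := by rw [div_eq_inv_mul]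
    rw [e1, e2]
    linarith
  have second : ∀ a, dirDeriv (P.col a) (dirDeriv (P.col a) (dirDeriv e (dirDeriv e g))) z / E
      - m a ^ 2 / E ^ 2 + (-1 / h - (q a / h) ^ 2) + (ε a ^ 2
      + γ * dirDeriv (P.col a) (dirDeriv (P.col a) (dirDeriv e g)) z) ≤ 0 := by
    intro a
    have := dirDeriv_dirDeriv_nonpos_of_isLocalMax hU ((s1.add s2).add s3) hz hmax (P.col a)
    rw [dirDeriv_dirDeriv_add hU (s1.add s2) s3 hz, dirDeriv_dirDeriv_add hU s1 s2 hz,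
      dirDeriv_dirDeriv_log hU hgee (fun y hy => (he y hy).ne') hz,
      dirDeriv_dirDeriv_log hU hη (fun y hy => (hη0 y hy).ne') hz,
      dirDeriv_dirDeriv_half_sq hU hge hz, hεa, hηg, hcol, Matrix.one_apply_eq] at this
    rw [div_pow, sq (m a), sq (q a)]
    exact this
  have total := Finset.sum_nonpos fun a (_ : a ∈ Finset.univ) => second a
  simp only [Finset.sum_add_distrib, Finset.sum_sub_distrib, ← Finset.sum_div,
    ← Finset.mul_sum] at total
  have t1' : ∑ a, dirDeriv (P.col a) (dirDeriv (P.col a) (dirDeriv e g)) z = γ := by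
    refine Eq.trans ?_ t1
    exact Finset.sum_congr rfl fun a _ => (dirDeriv_comm_three hU hg _ _ hz).symm
  have t2' : ∑ a, dirDeriv (P.col a) (dirDeriv (P.col a) (dirDeriv e (dirDeriv e g))) z
      = E + ∑ a, ∑ b, M a b ^ 2 := by
    refine Eq.trans ?_ t2
    refine Finset.sum_congr rfl fun a _ => ?_
    rw [← dirDeriv_comm_three hU hge _ _ hz]
    refine dirDeriv_congr_of_eventuallyEq ?_ e
    filter_upwards [hU.mem_nhds hz] with x hx using (dirDeriv_comm_three hU hg _ _ hx).symm
  have slack := two_mul_sum_sq_le_of_symm hMsymm hm hEsum hE0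
  set S := ∑ a, m a ^ 2 with hS
  set s := ∑ a, ε a * m a with hs
  set T := ∑ a, ∑ b, M a b ^ 2 with hT
  have hq2 : ∑ a, (q a / h) ^ 2 = S / E ^ 2 + 2 * γ * s / E + γ ^ 2 * E := by
    have : ∀ a, (q a / h) ^ 2
        = 1 / E ^ 2 * m a ^ 2 + 2 * γ / E * (ε a * m a) + γ ^ 2 * ε a ^ 2 := by
      intro a
      rw [crit]
      field_simp
      ring
    simp only [this, Finset.sum_add_distrib, ← Finset.mul_sum]
    rw [← hS, ← hs, ← hEsum]
    ring
  have hqe : dirDeriv e η z / h = -(s / E + γ * E) := by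
    rw [hde, Finset.sum_div]
    have : ∀ a, ε a * q a / h = -(1 / E * (ε a * m a) + γ * ε a ^ 2) := by
      intro a
      rw [mul_div_assoc, crit]
      field_simp
    have h' : ∑ a, ε a * dirDeriv (P.col a) η z / h
        = ∑ a, -(1 / E * (ε a * m a) + γ * ε a ^ 2) := Finset.sum_congr rfl fun a _ => this a
    rw [h']
    simp only [Finset.sum_neg_distrib, Finset.sum_add_distrib, ← Finset.mul_sum]
    rw [← hs, ← hEsum]
    ring
  have hqe2 : dirDeriv e η z ^ 2 / (E * h ^ 2) = s ^ 2 / E ^ 3 + 2 * γ * s / E + γ ^ 2 * E := by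
    have : dirDeriv e η z ^ 2 / (E * h ^ 2) = (dirDeriv e η z / h) ^ 2 / E := by
      field_simp
    rw [this, hqe]
    field_simp
    ring
  rw [t1', t2', hq2, ← hEsum] at total
  simp only [Finset.sum_const, Finset.card_univ, Fintype.card_fin, nsmul_eq_mul] at total
  rw [hqe2]
  have slack' : 2 * S / E ^ 2 - s ^ 2 / E ^ 3 ≤ T / E := by
    have := div_le_div_of_nonneg_right slack hE0.le
    have e1 : (2 * S / E - s ^ 2 / E ^ 2) / E = 2 * S / E ^ 2 - s ^ 2 / E ^ 3 := by
      field_simp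
    rwa [e1] at this
  have e1 : (E + T) / E = 1 + T / E := by field_simp
  have e2 : (d : ℝ) * -1 / h = -(d / h) := by ring
  have e3 : 2 * S / E ^ 2 = S / E ^ 2 + S / E ^ 2 := by ring
  rw [e1] at total
  nlinarith [sq_nonneg γ]

end Pogorelov

section MatrixInequalities

variable {n : Type*} [Fintype n] [DecidableEq n]

lemma Matrix.IsHermitian.sub_smul_one_eq {H : Matrix n n ℝ} (hH : H.IsHermitian) (c : ℝ) :
    H - c • (1 : Matrix n n ℝ) = (hH.eigenvectorUnitary : Matrix n n ℝ)
      * Matrix.diagonal (fun i => hH.eigenvalues i - c)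
      * (hH.eigenvectorUnitary : Matrix n n ℝ)ᴴ := by
  have h1 : (Matrix.diagonal (fun i => hH.eigenvalues i - c) : Matrix n n ℝ)
      = Matrix.diagonal (RCLike.ofReal ∘ hH.eigenvalues) - c • (1 : Matrix n n ℝ) := by
    ext i j
    by_cases hij : i = j
    · subst hij; simp
    · simp [hij]
  have h2 : (hH.eigenvectorUnitary : Matrix n n ℝ) * (hH.eigenvectorUnitary : Matrix n n ℝ)ᴴ = 1 :=
    Unitary.mul_star_self_of_mem hH.eigenvectorUnitary.2
  have h3 := hH.spectral_theorem
  rw [Unitary.conjStarAlgAut_apply] at h3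
  rw [h1, Matrix.mul_sub, Matrix.sub_mul]
  simp only [Matrix.mul_smul, Matrix.smul_mul, Matrix.mul_one, h2]
  congr 1

lemma Matrix.IsHermitian.posSemidef_sub_smul_one {H : Matrix n n ℝ} (hH : H.IsHermitian) {c : ℝ}
    (h : ∀ i, c ≤ hH.eigenvalues i) : (H - c • (1 : Matrix n n ℝ)).PosSemidef := by
  rw [hH.sub_smul_one_eq]
  exact (Matrix.PosSemidef.diagonal fun i => sub_nonneg.2 (h i)).mul_mul_conjTranspose_same _

lemma Matrix.IsHermitian.posSemidef_smul_one_sub {H : Matrix n n ℝ} (hH : H.IsHermitian) {c : ℝ}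
    (h : ∀ i, hH.eigenvalues i ≤ c) : (c • (1 : Matrix n n ℝ) - H).PosSemidef := by
  rw [← neg_sub, hH.sub_smul_one_eq, ← Matrix.neg_mul, ← Matrix.mul_neg, Matrix.diagonal_neg]
  refine (Matrix.PosSemidef.diagonal fun i => ?_).mul_mul_conjTranspose_same _
  simpa using h i

lemma Matrix.PosSemidef.one_le_det_one_add {N : Matrix n n ℝ} (hN : N.PosSemidef) :
    1 ≤ (1 + N).det := by
  have hC : (1 + N).IsHermitian := Matrix.isHermitian_one.add hN.1
  rw [hC.det_eq_prod_eigenvalues]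
  rw [← Finset.prod_const_one (ι := n) (s := Finset.univ)]
  refine Finset.prod_le_prod (fun _ _ => zero_le_one) fun i _ => ?_
  have hv := hC.eigenvectorBasis.orthonormal.1 i
  have h1 : star (⇑(hC.eigenvectorBasis i)) ⬝ᵥ ⇑(hC.eigenvectorBasis i) = (1 : ℝ) := by
    have := EuclideanSpace.inner_eq_star_dotProduct (𝕜 := ℝ)
      (hC.eigenvectorBasis i) (hC.eigenvectorBasis i)
    rw [real_inner_self_eq_norm_sq, hv] at this
    rw [dotProduct_comm]
    simpa using this.symm
  have h2 := hN.dotProduct_mulVec_nonneg ⇑(hC.eigenvectorBasis i)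
  have h3 := hC.eigenvalues_eq i
  rw [Matrix.add_mulVec, dotProduct_add, Matrix.one_mulVec, h1] at h3
  simp only [RCLike.re_to_real] at h3
  simp only [RCLike.ofReal_real_eq_id, id_eq]
  linarith

lemma Matrix.PosDef.det_le_det_of_posSemidef_sub {A B : Matrix n n ℝ} (hA : A.PosDef)
    (hAB : (B - A).PosSemidef) : A.det ≤ B.det := by
  obtain ⟨P, Q, hP, hPQ⟩ := hA.exists_isUnit_transpose_mul_mul_eq_one
  have hN : (Pᵀ * (B - A) * P).PosSemidef := by
    simpa using hAB.conjTranspose_mul_mul_same P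
  have h1 := hN.one_le_det_one_add
  rw [← hP, ← Matrix.add_mul, ← Matrix.mul_add, add_sub_cancel] at h1
  have h2 : Pᵀ.det * A.det * P.det = 1 := by
    rw [← Matrix.det_mul, ← Matrix.det_mul, hP, Matrix.det_one]
  rw [Matrix.det_mul, Matrix.det_mul] at h1
  rw [Matrix.det_transpose] at h1 h2
  have h3 : 0 < P.det ^ 2 := by
    have : P.det ≠ 0 := by rintro h; simp [h] at h2
    positivity
  nlinarith

/-- A positive definite matrix with bounded diagonal and determinant bounded below is
uniformly comparable to the identity. -/
lemma Matrix.PosDef.two_sided_bound {H : Matrix n n ℝ} (hH : H.PosDef) {C c : ℝ}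
    (hC : ∀ i, H i i ≤ C) (hc : c ≤ H.det) (hn : 0 < Fintype.card n) (hC0 : 0 < C) :
    (H - (c / (Fintype.card n * C) ^ (Fintype.card n - 1)) • (1 : Matrix n n ℝ)).PosSemidef ∧
    ((Fintype.card n * C) • (1 : Matrix n n ℝ) - H).PosSemidef := by
  have hh := hH.isHermitian
  have hpos := hh.posDef_iff_eigenvalues_pos.1 hH
  have htr : ∑ i, hh.eigenvalues i ≤ Fintype.card n * C := by
    have h1 := hh.trace_eq_sum_eigenvalues
    simp only [RCLike.ofReal_real_eq_id, id_eq] at h1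
    rw [← h1, Matrix.trace]
    refine (Finset.sum_le_sum fun i _ => hC i).trans ?_
    simp
  have hle : ∀ i, hh.eigenvalues i ≤ Fintype.card n * C := fun i =>
    (Finset.single_le_sum (f := hh.eigenvalues) (fun j _ => (hpos j).le)
      (Finset.mem_univ i)).trans htr
  refine ⟨hh.posSemidef_sub_smul_one fun i => ?_, hh.posSemidef_smul_one_sub hle⟩
  have hB : (0 : ℝ) < Fintype.card n * C := by positivity
  rw [div_le_iff₀ (by positivity)]
  refine hc.trans ?_
  rw [hh.det_eq_prod_eigenvalues]
  simp only [RCLike.ofReal_real_eq_id, id_eq]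
  rw [← Finset.mul_prod_erase Finset.univ _ (Finset.mem_univ i)]
  refine mul_le_mul_of_nonneg_left ?_ (hpos i).le
  refine (Finset.prod_le_prod (fun j _ => (hpos j).le) fun j _ => hle j).trans ?_
  simp [Finset.card_erase_of_mem]

end MatrixInequalities

section Barrier

variable {d : ℕ}

/-- The barycentric coordinates on the simplex: `x i`, together with `1 - ∑ x i`. -/
def baryCoord (a : Option (Fin d)) (x : Fin d → ℝ) : ℝ := a.elim (1 - ∑ i, x i) x

/-- The linear part of `baryCoord a`. -/
def baryDir (a : Option (Fin d)) (v : Fin d → ℝ) : ℝ := a.elim (-∑ i, v i) v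

@[simp] lemma baryCoord_none (x : Fin d → ℝ) : baryCoord none x = 1 - ∑ i, x i := rfl

@[simp] lemma baryCoord_some (i : Fin d) (x : Fin d → ℝ) : baryCoord (some i) x = x i := rfl

@[simp] lemma baryDir_none (v : Fin d → ℝ) : baryDir none v = -∑ i, v i := rfl

@[simp] lemma baryDir_some (i : Fin d) (v : Fin d → ℝ) : baryDir (some i) v = v i := rfl

lemma mem_simplexΔ_iff {x : Fin d → ℝ} : x ∈ simplexΔ d ↔ ∀ a, 0 < baryCoord a x := by
  simp [simplexΔ, Option.forall, and_comm]

lemma sum_baryCoord (x : Fin d → ℝ) : ∑ a, baryCoord a x = 1 := by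
  simp [Fintype.sum_option]

lemma baryCoord_add (a : Option (Fin d)) (x v : Fin d → ℝ) :
    baryCoord a (x + v) = baryCoord a x + baryDir a v := by
  cases a <;> simp [Finset.sum_add_distrib]
  ring

lemma baryDir_smul (a : Option (Fin d)) (t : ℝ) (v : Fin d → ℝ) :
    baryDir a (t • v) = t * baryDir a v := by
  cases a <;> simp [Finset.mul_sum]

lemma contDiff_baryCoord (a : Option (Fin d)) {n : WithTop ℕ∞} :
    ContDiff ℝ n (baryCoord (d := d) a) := by
  cases a
  · exact contDiff_const.sub (ContDiff.sum fun i _ => contDiff_apply ℝ ℝ i)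
  · exact contDiff_apply ℝ ℝ _

@[fun_prop]
lemma continuous_baryCoord (a : Option (Fin d)) : Continuous (baryCoord (d := d) a) :=
  (contDiff_baryCoord a (n := 0)).continuous

lemma dirDeriv_baryCoord (a : Option (Fin d)) (v : Fin d → ℝ) :
    dirDeriv v (baryCoord a) = fun _ => baryDir a v := by
  funext y
  have hd : DifferentiableAt ℝ (baryCoord (d := d) a) (y + (0 : ℝ) • v) :=
    (contDiff_baryCoord a (n := 1)).differentiable (by simp) _
  have h1 := hasDerivAt_line hd
  have h2 : HasDerivAt (fun s : ℝ => baryCoord a (y + s • v)) (baryDir a v) 0 := by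
    simp only [baryCoord_add, baryDir_smul]
    simpa using ((hasDerivAt_id (0 : ℝ)).mul_const (baryDir a v)).const_add (baryCoord a y)
  simpa using h1.unique h2

lemma isOpen_baryCoord_gt (δ : ℝ) : IsOpen {x : Fin d → ℝ | ∀ a, δ < baryCoord a x} := by
  simp only [Set.ofPred_forall]
  exact isOpen_iInter_of_finite fun a => isOpen_lt continuous_const (continuous_baryCoord a)

lemma isOpen_simplexΔ : IsOpen (simplexΔ d) := by
  convert isOpen_baryCoord_gt (d := d) 0 using 1
  ext x; exact mem_simplexΔ_iff

lemma baryCoord_le_one {x : Fin d → ℝ} (hx : ∀ a, 0 ≤ baryCoord a x) (a : Option (Fin d)) :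
    baryCoord a x ≤ 1 := by
  rw [← sum_baryCoord x]
  exact Finset.single_le_sum (f := fun a => baryCoord a x) (fun b _ => hx b) (Finset.mem_univ a)

lemma isCompact_baryCoord_ge {r : Option (Fin d) → ℝ} (hr : ∀ a, 0 ≤ r a) :
    IsCompact {x : Fin d → ℝ | ∀ a, r a ≤ baryCoord a x} := by
  have hcl : IsClosed {x : Fin d → ℝ | ∀ a, r a ≤ baryCoord a x} := by
    simp only [Set.ofPred_forall]
    exact isClosed_iInter fun a => isClosed_le continuous_const (continuous_baryCoord a)
  refine (isCompact_Icc (a := (0 : Fin d → ℝ)) (b := 1)).of_isClosed_subset hcl fun x hx => ?_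
  have h0 : ∀ a, 0 ≤ baryCoord a x := fun a => (hr a).trans (hx a)
  exact ⟨fun i => h0 (some i), fun i => baryCoord_le_one h0 (some i)⟩

/-- The barrier `-2 ∑ log (ℓ - δ)`, summed over the barycentric coordinates `ℓ`. -/
def shiftedBarrier (δ : ℝ) (x : Fin d → ℝ) : ℝ := ∑ a, -2 * Real.log (baryCoord a x - δ)

lemma contDiffOn_log_baryCoord_sub (δ : ℝ) (a : Option (Fin d)) :
    ContDiffOn ℝ (⊤ : ℕ∞) (fun x => Real.log (baryCoord a x - δ))
      {x : Fin d → ℝ | ∀ a, δ < baryCoord a x} :=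
  ((contDiff_baryCoord a).sub contDiff_const).contDiffOn.log
    fun _ hx => (sub_pos.2 (hx a)).ne'

lemma contDiffOn_shiftedBarrier (δ : ℝ) :
    ContDiffOn ℝ (⊤ : ℕ∞) (shiftedBarrier (d := d) δ) {x | ∀ a, δ < baryCoord a x} :=
  ContDiffOn.sum fun a _ => contDiffOn_const.mul (contDiffOn_log_baryCoord_sub δ a)

lemma dirDeriv_baryCoord_sub (δ : ℝ) (a : Option (Fin d)) (v : Fin d → ℝ) :
    dirDeriv v (fun x => baryCoord a x - δ) = fun _ => baryDir a v := by
  rw [← dirDeriv_baryCoord]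
  funext y
  change fderiv ℝ (fun x => baryCoord a x - δ) y v = _
  rw [fderiv_sub_const]
  rfl

lemma dirDeriv_dirDeriv_shiftedBarrier {δ : ℝ} {x : Fin d → ℝ} (hx : ∀ a, δ < baryCoord a x)
    (v w : Fin d → ℝ) :
    dirDeriv w (dirDeriv v (shiftedBarrier δ)) x
      = ∑ a, 2 * (baryDir a w * baryDir a v / (baryCoord a x - δ) ^ 2) := by
  have hU := isOpen_baryCoord_gt (d := d) δ
  have h1 : dirDeriv v (shiftedBarrier δ) =ᶠ[nhds x]
      fun y => ∑ a, -2 * dirDeriv v (fun x => Real.log (baryCoord a x - δ)) y := by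
    filter_upwards [hU.mem_nhds hx] with y hy
    exact dirDeriv_sum_of_differentiableAt _ _ _
      (fun a _ => (contDiffOn_log_baryCoord_sub δ a).differentiableAt_of_mem hU hy) _
  rw [dirDeriv_congr_of_eventuallyEq h1, dirDeriv_sum_of_differentiableAt _ _ _ (fun a _ =>
    ((contDiffOn_log_baryCoord_sub δ a).dirDeriv hU v).differentiableAt_of_mem hU hx)]
  refine Finset.sum_congr rfl fun a _ => ?_
  rw [dirDeriv_dirDeriv_log hU ((contDiff_baryCoord a).sub contDiff_const).contDiffOn
    (fun y hy => (sub_pos.2 (hy a)).ne') hx, dirDeriv_baryCoord_sub, dirDeriv_baryCoord_sub]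
  simp [dirDeriv]

lemma half_smul_hess_shiftedBarrier {δ : ℝ} {x : Fin d → ℝ} (hx : ∀ a, δ < baryCoord a x) :
    (2 : ℝ)⁻¹ • hess d (shiftedBarrier δ) x
      = (Matrix.diagonal (fun i => ((x i - δ) ^ 2)⁻¹) : Matrix (Fin d) (Fin d) ℝ)
        + Matrix.replicateCol Unit (fun _ : Fin d => ((baryCoord none x - δ) ^ 2)⁻¹)
          * Matrix.replicateRow Unit (fun _ : Fin d => (1 : ℝ)) := by
  ext i j
  have : hess d (shiftedBarrier δ) x i j
    = dirDeriv (Pi.single i 1) (dirDeriv (Pi.single j 1) (shiftedBarrier δ)) x := rfl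
  have hsum : ∑ l, (Pi.single i 1 : Fin d → ℝ) l * (Pi.single j 1 : Fin d → ℝ) l / (x l - δ) ^ 2
      = if i = j then ((x i - δ) ^ 2)⁻¹ else 0 := by
    rw [Finset.sum_eq_single i (fun l _ hl => by simp [hl]) (by simp)]
    by_cases hij : i = j
    · subst hij; simp
    · simp [hij]
  rw [Matrix.smul_apply, this, dirDeriv_dirDeriv_shiftedBarrier hx, ← Finset.mul_sum,
    Fintype.sum_option]
  simp only [baryDir_none, baryDir_some, baryCoord_some, smul_eq_mul, Matrix.add_apply,
    Matrix.mul_apply, Matrix.replicateCol_apply, Matrix.replicateRow_apply, hsum,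
    Matrix.diagonal_apply]
  simp
  ring

lemma exp_shiftedBarrier {δ : ℝ} {x : Fin d → ℝ} (hx : ∀ a, δ < baryCoord a x) :
    Real.exp (shiftedBarrier δ x) = ∏ a, ((baryCoord a x - δ) ^ 2)⁻¹ := by
  rw [shiftedBarrier, Real.exp_sum]
  refine Finset.prod_congr rfl fun a _ => ?_
  rw [show -2 * Real.log (baryCoord a x - δ) = -Real.log ((baryCoord a x - δ) ^ 2) by
    rw [Real.log_pow]; push_cast; ring, Real.exp_neg,
    Real.exp_log (pow_pos (sub_pos.2 (hx a)) 2)]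

lemma det_half_smul_hess_shiftedBarrier {δ : ℝ} {x : Fin d → ℝ} (hx : ∀ a, δ < baryCoord a x) :
    ((2 : ℝ)⁻¹ • hess d (shiftedBarrier δ) x).det
      = Real.exp (shiftedBarrier δ x) * ∑ a, (baryCoord a x - δ) ^ 2 := by
  have hp : ∀ a, 0 < baryCoord a x - δ := fun a => sub_pos.2 (hx a)
  have hdet : (Matrix.diagonal (fun i => ((x i - δ) ^ 2)⁻¹)).det = ∏ i, ((x i - δ) ^ 2)⁻¹ :=
    Matrix.det_diagonal
  have hne : ∀ i, ((x i - δ) ^ 2)⁻¹ ≠ 0 := fun i => (inv_pos.2 (pow_pos (hp (some i)) 2)).ne'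
  have hinv : (Matrix.diagonal (fun i => ((x i - δ) ^ 2)⁻¹))⁻¹
      = Matrix.diagonal (fun i => (x i - δ) ^ 2) := by
    refine Matrix.inv_eq_right_inv ?_
    rw [Matrix.diagonal_mul_diagonal, ← Matrix.diagonal_one]
    congr 1
    funext i
    exact inv_mul_cancel₀ (pow_pos (hp (some i)) 2).ne'
  rw [half_smul_hess_shiftedBarrier hx, Matrix.det_add_replicateCol_mul_replicateRow, hdet, hinv,
    exp_shiftedBarrier hx, Fintype.prod_option, Fintype.sum_option, Matrix.det_unique]
  · have h0 := hp none
    simp only [Matrix.add_apply, Matrix.one_apply_eq, Matrix.mul_apply,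
      Matrix.replicateRow_apply, Matrix.replicateCol_apply, one_mul, ← Finset.sum_mul,
      Matrix.diagonal_apply, Finset.sum_ite_eq', Finset.mem_univ, if_true,
      baryCoord_some]
    field_simp
  · rw [hdet]
    exact (Finset.prod_ne_zero_iff.2 fun i _ => hne i).isUnit

end Barrier

section Comparison

variable {d : ℕ} {U : Set (Fin d → ℝ)} {f g h : (Fin d → ℝ) → ℝ}

lemma isHermitian_hess (hU : IsOpen U) (hg : ContDiffOn ℝ (⊤ : ℕ∞) g U) {y : Fin d → ℝ}
    (hy : y ∈ U) : (hess d g y).IsHermitian :=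
  Matrix.IsHermitian.ext fun _ _ => dirDeriv_comm hU hg _ _ hy

lemma posDef_hess_of_pos (hU : IsOpen U) (hg : ContDiffOn ℝ (⊤ : ℕ∞) g U) {y : Fin d → ℝ}
    (hy : y ∈ U) (h : ∀ v ≠ 0, 0 < dirDeriv v (dirDeriv v g) y) : (hess d g y).PosDef := by
  refine Matrix.PosDef.of_dotProduct_mulVec_pos (isHermitian_hess hU hg hy) fun v hv => ?_
  rw [star_trivial, ← dirDeriv_dirDeriv_eq_dotProduct hU hg hy]
  exact h v hv

lemma Matrix.PosDef.dirDeriv_dirDeriv_pos (hU : IsOpen U) (hg : ContDiffOn ℝ (⊤ : ℕ∞) g U)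
    {y : Fin d → ℝ} (hy : y ∈ U) (h : (hess d g y).PosDef) {v : Fin d → ℝ} (hv : v ≠ 0) :
    0 < dirDeriv v (dirDeriv v g) y := by
  rw [dirDeriv_dirDeriv_eq_dotProduct hU hg hy]
  simpa using h.dotProduct_mulVec_pos hv

lemma det_hess_le_of_isLocalMax_sub (hU : IsOpen U) (hf : ContDiffOn ℝ (⊤ : ℕ∞) f U)
    (hh : ContDiffOn ℝ (⊤ : ℕ∞) h U) {z : Fin d → ℝ} (hz : z ∈ U) (hpos : (hess d f z).PosDef)
    (hmax : IsLocalMax (fun y => f y - h y) z) :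
    ((2 : ℝ)⁻¹ • hess d f z).det ≤ ((2 : ℝ)⁻¹ • hess d h z).det := by
  refine Matrix.PosDef.det_le_det_of_posSemidef_sub (hpos.smul (by norm_num)) ?_
  rw [← smul_sub]
  refine Matrix.PosSemidef.smul (.of_dotProduct_mulVec_nonneg
    ((isHermitian_hess hU hh hz).sub (isHermitian_hess hU hf hz)) fun v => ?_) (by norm_num)
  have hsub := dirDeriv_dirDeriv_nonpos_of_isLocalMax hU (hf.sub hh) hz hmax v
  have hadd := dirDeriv_dirDeriv_add hU (hf.sub hh) hh hz v
  simp only [sub_add_cancel] at hadd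
  rw [star_trivial, Matrix.sub_mulVec, dotProduct_sub,
    ← dirDeriv_dirDeriv_eq_dotProduct hU hh hz, ← dirDeriv_dirDeriv_eq_dotProduct hU hf hz]
  change dirDeriv v (dirDeriv v (fun y => f y - h y)) z ≤ 0 at hsub
  change dirDeriv v (dirDeriv v f) z
    = dirDeriv v (dirDeriv v (fun y => f y - h y)) z + _ at hadd
  linarith

lemma continuousAt_shiftedBarrier_zero {x : Fin d → ℝ} (hx : x ∈ simplexΔ d) :
    ContinuousAt (fun δ => shiftedBarrier δ x) 0 := by
  have hp := mem_simplexΔ_iff.1 hx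
  unfold shiftedBarrier
  refine tendsto_finsetSum _ fun a _ => ?_
  refine Tendsto.const_mul _ ?_
  exact ContinuousAt.log (by fun_prop) (by simpa using (hp a).ne')

lemma posDef_hess_shiftedBarrier {δ : ℝ} {x : Fin d → ℝ} (hx : ∀ a, δ < baryCoord a x) :
    (hess d (shiftedBarrier δ) x).PosDef := by
  refine posDef_hess_of_pos (isOpen_baryCoord_gt δ) (contDiffOn_shiftedBarrier δ) hx
    fun v hv => ?_
  rw [dirDeriv_dirDeriv_shiftedBarrier hx]
  obtain ⟨i, hi⟩ := Function.ne_iff.1 hv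
  have hp : ∀ a, 0 < (baryCoord a x - δ) ^ 2 := fun a => pow_pos (sub_pos.2 (hx a)) 2
  refine Finset.sum_pos' (fun a _ => ?_) ⟨some i, Finset.mem_univ _, ?_⟩
  · exact mul_nonneg zero_le_two (div_nonneg (mul_self_nonneg _) (hp a).le)
  · exact mul_pos zero_lt_two (div_pos (mul_self_pos.2 hi) (hp _))

variable (hg : ContDiffOn ℝ (⊤ : ℕ∞) g (simplexΔ d))
  (hpos : ∀ x ∈ simplexΔ d, (hess d g x).PosDef)
  (hdet : ∀ x ∈ simplexΔ d, ((2 : ℝ)⁻¹ • hess d g x).det = Real.exp (g x))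

include hg hpos hdet in
lemma le_shiftedBarrier {δ : ℝ} (hδ : 0 < δ) {x : Fin d → ℝ} (hx : ∀ a, δ < baryCoord a x) :
    g x ≤ shiftedBarrier δ x := by
  have hsub : {y : Fin d → ℝ | ∀ a, δ ≤ baryCoord a y} ⊆ simplexΔ d := fun y hy =>
    mem_simplexΔ_iff.2 fun a => hδ.trans_le (hy a)
  have hlt : {y : Fin d → ℝ | ∀ a, δ < baryCoord a y} ⊆ simplexΔ d := fun y hy =>
    mem_simplexΔ_iff.2 fun a => hδ.trans (hy a)
  have hcont : ContinuousOn (fun y => Real.exp (g y) * ∏ a, (baryCoord a y - δ) ^ 2)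
      {y : Fin d → ℝ | ∀ a, δ ≤ baryCoord a y} := by
    refine ContinuousOn.mul (Real.continuous_exp.comp_continuousOn (hg.continuousOn.mono hsub)) ?_
    exact Continuous.continuousOn (by fun_prop)
  obtain ⟨z, hzK, hz⟩ := (isCompact_baryCoord_ge (fun _ => hδ.le)).exists_isMaxOn
    ⟨x, fun a => (hx a).le⟩ hcont
  have hQ : ∀ y : Fin d → ℝ, (∀ a, δ < baryCoord a y) →
      Real.exp (g y) * ∏ a, (baryCoord a y - δ) ^ 2 = Real.exp (g y - shiftedBarrier δ y) := by
    intro y hy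
    rw [Real.exp_sub, exp_shiftedBarrier hy, Finset.prod_inv_distrib, div_inv_eq_mul]
  have hzx := hz (show x ∈ {y : Fin d → ℝ | ∀ a, δ ≤ baryCoord a y} from fun a => (hx a).le)
  simp only [Set.mem_ofPred_eq, hQ x hx] at hzx
  have hzδ : ∀ a, δ < baryCoord a z := by
    intro a
    refine lt_of_le_of_ne (hzK a) fun h0 => ?_
    rw [Finset.prod_eq_zero (Finset.mem_univ a) (by simp [← h0]), mul_zero] at hzx
    exact absurd hzx (Real.exp_pos _).not_ge
  have hU := isOpen_baryCoord_gt (d := d) δ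
  have hmax : IsLocalMax (fun y => g y - shiftedBarrier δ y) z := by
    filter_upwards [hU.mem_nhds hzδ] with y hy
    have := hz (show y ∈ {y : Fin d → ℝ | ∀ a, δ ≤ baryCoord a y} from fun a => (hy a).le)
    simp only [Set.mem_ofPred_eq, hQ y hy, hQ z hzδ] at this
    exact Real.exp_le_exp.1 this
  have hle := det_hess_le_of_isLocalMax_sub hU (hg.mono hlt) (contDiffOn_shiftedBarrier δ) hzδ
    (hpos z (hlt hzδ)) hmax
  rw [hdet z (hlt hzδ), det_half_smul_hess_shiftedBarrier hzδ] at hle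
  have hsum : ∑ a, (baryCoord a z - δ) ^ 2 ≤ 1 := by
    rw [← sum_baryCoord z]
    refine Finset.sum_le_sum fun a _ => ?_
    have h1 := baryCoord_le_one (fun a => (hδ.trans (hzδ a)).le) a
    nlinarith [hzδ a]
  have h2 := Real.exp_le_exp.1 (hle.trans (mul_le_of_le_one_right (Real.exp_pos _).le hsum))
  rw [hQ z hzδ] at hzx
  linarith [Real.exp_le_exp.1 hzx]

include hg hpos hdet in
lemma le_shiftedBarrier_zero {x : Fin d → ℝ} (hx : x ∈ simplexΔ d) : g x ≤ shiftedBarrier 0 x := by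
  refine ge_of_tendsto ((continuousAt_shiftedBarrier_zero hx).tendsto.mono_left
    (nhdsWithin_le_nhds (s := Set.Ioi 0))) ?_
  have hev : ∀ᶠ δ : ℝ in nhds 0, ∀ a, δ < baryCoord a x :=
    eventually_all.2 fun a => eventually_lt_nhds (mem_simplexΔ_iff.1 hx a)
  filter_upwards [self_mem_nhdsWithin, nhdsWithin_le_nhds hev] with δ h0 h1
  exact le_shiftedBarrier hg hpos hdet h0 h1

lemma isCompact_sublevel (hc : ContinuousOn g (simplexΔ d))
    (hbd : ∀ x0 ∈ frontier (simplexΔ d), Tendsto g (nhdsWithin x0 (simplexΔ d)) atTop) (N : ℝ) :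
    IsCompact {y ∈ simplexΔ d | g y ≤ N} := by
  have hcl : IsClosed {y ∈ simplexΔ d | g y ≤ N} := by
    refine isClosed_of_closure_subset fun y hy => ?_
    by_contra hcon
    have hev : ∀ᶠ w in nhdsWithin y (simplexΔ d), N < g w := by
      by_cases hyΔ : y ∈ simplexΔ d
      · exact (hc y hyΔ).eventually_const_lt (not_le.1 fun h => hcon ⟨hyΔ, h⟩)
      · refine (hbd y ?_).eventually_gt_atTop N
        rw [isOpen_simplexΔ.frontier_eq]
        exact ⟨closure_mono (fun w hw => hw.1) hy, hyΔ⟩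
    refine mem_closure_iff_frequently.1 hy ?_
    filter_upwards [eventually_nhdsWithin_iff.1 hev] with w hw hw'
    exact absurd hw'.2 (hw hw'.1).not_ge
  exact (isCompact_baryCoord_ge (fun _ => le_rfl)).of_isClosed_subset hcl
    fun y hy a => (mem_simplexΔ_iff.1 hy.1 a).le

include hg hdet in
lemma shiftedBarrier_neg_le
    (hbd : ∀ x0 ∈ frontier (simplexΔ d), Tendsto g (nhdsWithin x0 (simplexΔ d)) atTop)
    {δ : ℝ} (hδ : 0 < δ) {x : Fin d → ℝ} (hx : x ∈ simplexΔ d) :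
    shiftedBarrier (-δ) x ≤ g x + Real.log (d + 1) := by
  have hgt : ∀ y ∈ simplexΔ d, ∀ a, -δ < baryCoord a y := fun y hy a =>
    (neg_lt_zero.2 hδ).trans (mem_simplexΔ_iff.1 hy a)
  have hV : ContDiffOn ℝ (⊤ : ℕ∞) (shiftedBarrier (-δ)) (simplexΔ d) :=
    (contDiffOn_shiftedBarrier (-δ)).mono hgt
  set M : ℝ := ∑ _a : Option (Fin d), -2 * Real.log δ with hM
  have hVM : ∀ y ∈ simplexΔ d, shiftedBarrier (-δ) y ≤ M := by
    intro y hy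
    refine Finset.sum_le_sum fun a _ => ?_
    have := Real.log_le_log hδ (show δ ≤ baryCoord a y - -δ by
      linarith [mem_simplexΔ_iff.1 hy a])
    linarith
  set N := M - shiftedBarrier (-δ) x + g x with hN
  obtain ⟨z, hzK, hz⟩ := (isCompact_sublevel hg.continuousOn hbd N).exists_isMaxOn
    ⟨x, hx, by linarith [hVM x hx]⟩
    ((hV.continuousOn.sub hg.continuousOn).mono fun y hy => hy.1)
  have hzx := hz (show x ∈ {y ∈ simplexΔ d | g y ≤ N} from ⟨hx, by linarith [hVM x hx]⟩)
  simp only [Set.mem_ofPred_eq, Pi.sub_apply] at hzx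
  have hmax : IsLocalMax (fun y => shiftedBarrier (-δ) y - g y) z := by
    filter_upwards [isOpen_simplexΔ.mem_nhds hzK.1] with y hy
    by_cases hyN : g y ≤ N
    · exact hz (show y ∈ {y ∈ simplexΔ d | g y ≤ N} from ⟨hy, hyN⟩)
    · linarith [hVM y hy, not_le.1 hyN]
  have hle := det_hess_le_of_isLocalMax_sub isOpen_simplexΔ hV hg hzK.1
    (posDef_hess_shiftedBarrier (hgt z hzK.1)) hmax
  rw [hdet z hzK.1, det_half_smul_hess_shiftedBarrier (hgt z hzK.1)] at hle
  have hsum : 1 ≤ (d + 1 : ℝ) * ∑ a, (baryCoord a z - -δ) ^ 2 := by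
    have h1 : (1 : ℝ) ≤ ∑ a, (baryCoord a z - -δ) := by
      rw [← sum_baryCoord z]
      exact Finset.sum_le_sum fun a _ => by linarith
    have h2 := sq_sum_le_card_mul_sum_sq (s := Finset.univ) (f := fun a => baryCoord a z - -δ)
    rw [Finset.card_univ, Fintype.card_option, Fintype.card_fin] at h2
    push_cast at h2
    nlinarith
  have h3 : Real.exp (shiftedBarrier (-δ) z) ≤ Real.exp (g z + Real.log (d + 1)) := by
    rw [Real.exp_add, Real.exp_log (by positivity)]
    have := mul_le_mul_of_nonneg_left hle (show (0 : ℝ) ≤ d + 1 by positivity)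
    nlinarith [mul_le_mul_of_nonneg_left hsum (Real.exp_pos (shiftedBarrier (-δ) z)).le]
  linarith [Real.exp_le_exp.1 h3]

include hg hdet in
lemma shiftedBarrier_zero_le
    (hbd : ∀ x0 ∈ frontier (simplexΔ d), Tendsto g (nhdsWithin x0 (simplexΔ d)) atTop)
    {x : Fin d → ℝ} (hx : x ∈ simplexΔ d) :
    shiftedBarrier 0 x ≤ g x + Real.log (d + 1) := by
  refine le_of_tendsto ((continuousAt_shiftedBarrier_zero hx).tendsto.mono_left
    (nhdsWithin_le_nhds (s := Set.Iio 0))) ?_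
  filter_upwards [self_mem_nhdsWithin] with δ h0
  simpa using shiftedBarrier_neg_le hg hdet hbd (neg_pos.2 h0) hx

end Comparison

section SecondDerivativeBound

variable {d : ℕ} {g : (Fin d → ℝ) → ℝ} (hg : ContDiffOn ℝ (⊤ : ℕ∞) g (simplexΔ d))
  (hpos : ∀ x ∈ simplexΔ d, (hess d g x).PosDef)

lemma add_smul_mem_simplexΔ {z v : Fin d → ℝ} (hz : z ∈ simplexΔ d) (hzv : z + v ∈ simplexΔ d)
    {t : ℝ} (ht : t ∈ Set.Icc (0 : ℝ) 1) : z + t • v ∈ simplexΔ d := by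
  rw [mem_simplexΔ_iff] at *
  intro a
  have h1 := hz a
  have h2 := hzv a
  rw [baryCoord_add] at h2
  rw [baryCoord_add, baryDir_smul]
  rcases ht.2.eq_or_lt with rfl | h
  · simpa using h2
  · nlinarith [mul_pos (sub_pos.2 h) h1, mul_nonneg ht.1 h2.le]

include hg hpos in
lemma add_dirDeriv_le {z v : Fin d → ℝ} (hz : z ∈ simplexΔ d) (hzv : z + v ∈ simplexΔ d) :
    g z + dirDeriv v g z ≤ g (z + v) := by
  have hmem := fun t (ht : t ∈ Set.Icc (0 : ℝ) 1) => add_smul_mem_simplexΔ hz hzv ht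
  have hd1 : ∀ t ∈ Set.Icc (0 : ℝ) 1,
      HasDerivAt (fun s : ℝ => g (z + s • v)) (dirDeriv v g (z + t • v)) t := fun t ht =>
    hasDerivAt_line (hg.differentiableAt_of_mem isOpen_simplexΔ (hmem t ht))
  have hconv : ConvexOn ℝ (Set.Icc (0 : ℝ) 1) (fun s : ℝ => g (z + s • v)) := by
    refine convexOn_of_hasDerivWithinAt2_nonneg (convex_Icc 0 1)
      (fun t ht => (hd1 t ht).continuousAt.continuousWithinAt)
      (fun t ht => (hd1 t (interior_subset ht)).hasDerivWithinAt)
      (fun t ht => (hasDerivAt_line ((hg.dirDeriv isOpen_simplexΔ v).differentiableAt_of_mem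
        isOpen_simplexΔ (hmem t (interior_subset ht)))).hasDerivWithinAt) fun t ht => ?_
    have ht' := hmem t (interior_subset ht)
    rw [dirDeriv_dirDeriv_eq_dotProduct isOpen_simplexΔ hg ht']
    simpa using (hpos _ ht').posSemidef.dotProduct_mulVec_nonneg v
  have := hconv.le_slope_of_hasDerivAt (Set.left_mem_Icc.2 zero_le_one)
    (Set.right_mem_Icc.2 zero_le_one) one_pos (hd1 0 (Set.left_mem_Icc.2 zero_le_one))
  simp [slope_def_field] at this
  linarith

/-- A bound for the increment of the solution between points with comparable barycentric
coordinates. -/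
def incrementBound (d : ℕ) : ℝ := 2 * (d + 1) * Real.log 2 + Real.log (d + 1)

variable (hup : ∀ x ∈ simplexΔ d, g x ≤ shiftedBarrier 0 x)
  (hlow : ∀ x ∈ simplexΔ d, shiftedBarrier 0 x ≤ g x + Real.log (d + 1))

include hup hlow in
lemma le_add_incrementBound {z w : Fin d → ℝ} (hz : z ∈ simplexΔ d)
    (hw : ∀ a, baryCoord a z / 2 ≤ baryCoord a w) : g w ≤ g z + incrementBound d := by
  have hzp := mem_simplexΔ_iff.1 hz
  have hw' : w ∈ simplexΔ d := mem_simplexΔ_iff.2 fun a => (half_pos (hzp a)).trans_le (hw a)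
  have hV : shiftedBarrier 0 w ≤ shiftedBarrier 0 z + 2 * (d + 1) * Real.log 2 := by
    have h1 : ∀ a : Option (Fin d), -2 * Real.log (baryCoord a w - 0)
        ≤ -2 * Real.log (baryCoord a z - 0) + 2 * Real.log 2 := by
      intro a
      have := Real.log_le_log (half_pos (hzp a)) (hw a)
      rw [Real.log_div (hzp a).ne' two_ne_zero] at this
      simp only [sub_zero]
      linarith
    have h2 := Finset.sum_le_sum fun a (_ : a ∈ Finset.univ) => h1 a
    rw [Finset.sum_add_distrib, Finset.sum_const, Finset.card_univ, Fintype.card_option,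
      Fintype.card_fin, nsmul_eq_mul] at h2
    push_cast at h2
    unfold shiftedBarrier
    linarith
  have h1 := hup w hw'
  have h2 := hlow z hz
  unfold incrementBound
  linarith

include hg hpos hup hlow in
lemma abs_dirDeriv_le {z v : Fin d → ℝ} (hz : z ∈ simplexΔ d)
    (hv : ∀ a, |baryDir a v| ≤ baryCoord a z / 2) : |dirDeriv v g z| ≤ incrementBound d := by
  have key : ∀ u : Fin d → ℝ, (∀ a, |baryDir a u| ≤ baryCoord a z / 2) →
      dirDeriv u g z ≤ incrementBound d := by
    intro u hu
    have hw : ∀ a, baryCoord a z / 2 ≤ baryCoord a (z + u) := fun a => by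
      rw [baryCoord_add]
      linarith [neg_le_of_abs_le (hu a)]
    have hmem : z + u ∈ simplexΔ d := mem_simplexΔ_iff.2 fun a =>
      (half_pos (mem_simplexΔ_iff.1 hz a)).trans_le (hw a)
    linarith [add_dirDeriv_le hg hpos hz hmem, le_add_incrementBound hup hlow hz hw]
  refine abs_le.2 ⟨?_, key v hv⟩
  have := key (-v) fun a => by
    rw [← neg_one_smul ℝ v, baryDir_smul, neg_one_mul, abs_neg]
    exact hv a
  simp only [dirDeriv, map_neg] at this ⊢
  linarith

/-- Points where the cutoff function of Pogorelov's estimate centred at `x` is positive have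
barycentric coordinates at least `cutoffRatio d` times those of `x`. -/
def cutoffRatio (d : ℕ) : ℝ := Real.exp (-((Real.log (d + 1) + 1) / 2 + 1))

lemma cutoffRatio_pos (d : ℕ) : 0 < cutoffRatio d := Real.exp_pos _

lemma cutoffRatio_le_one (d : ℕ) : cutoffRatio d ≤ 1 := by
  have h2 := Real.log_nonneg (show (1 : ℝ) ≤ d + 1 by simp)
  exact Real.exp_le_one_iff.2 (by linarith)

/-- The affine function `ŵ + 1 + ⟨∇ŵ, · - x⟩` at `x`, for the barrier `ŵ = shiftedBarrier 0`. -/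
def tangentBarrier (x y : Fin d → ℝ) : ℝ :=
  (shiftedBarrier 0 x + 1 + 2 * (d + 1)) + ∑ a, -2 / baryCoord a x * baryCoord a y

lemma contDiff_tangentBarrier (x : Fin d → ℝ) : ContDiff ℝ (⊤ : ℕ∞) (tangentBarrier x) :=
  contDiff_const.add (ContDiff.sum fun a _ => contDiff_const.mul (contDiff_baryCoord a))

lemma dirDeriv_tangentBarrier (x v : Fin d → ℝ) :
    dirDeriv v (tangentBarrier x) = fun _ => ∑ a, -2 / baryCoord a x * baryDir a v := by
  funext y
  have h : dirDeriv v (tangentBarrier x) y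
      = dirDeriv v (fun y => ∑ a, -2 / baryCoord a x * baryCoord a y) y := by
    change fderiv ℝ (fun y => _ + ∑ a, -2 / baryCoord a x * baryCoord a y) y v = _
    rw [fderiv_const_add]
    rfl
  rw [h, dirDeriv_sum_of_differentiableAt _ _ _
    (fun a _ => (contDiff_baryCoord a (n := 1)).differentiable (by simp) _)]
  simp only [dirDeriv_baryCoord]

lemma tangentBarrier_self {x : Fin d → ℝ} (hx : x ∈ simplexΔ d) :
    tangentBarrier x x = shiftedBarrier 0 x + 1 := by
  have : ∀ a, -2 / baryCoord a x * baryCoord a x = -2 := fun a =>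
    div_mul_cancel₀ _ (mem_simplexΔ_iff.1 hx a).ne'
  simp only [tangentBarrier, this, Finset.sum_const, Finset.card_univ, Fintype.card_option,
    Fintype.card_fin, nsmul_eq_mul]
  push_cast
  ring

include hlow in
lemma cutoffRatio_mul_le {x y : Fin d → ℝ} (hx : x ∈ simplexΔ d) (hy : y ∈ simplexΔ d)
    (h : 0 < tangentBarrier x y - g y) (a : Option (Fin d)) :
    cutoffRatio d * baryCoord a x ≤ baryCoord a y := by
  have hxp := mem_simplexΔ_iff.1 hx
  have hyp := mem_simplexΔ_iff.1 hy
  set T : Option (Fin d) → ℝ := fun a => baryCoord a y / baryCoord a x with hT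
  have hTp : ∀ a, 0 < T a := fun a => div_pos (hyp a) (hxp a)
  have hlog : ∀ a, Real.log (T a) = Real.log (baryCoord a y) - Real.log (baryCoord a x) :=
    fun a => Real.log_div (hyp a).ne' (hxp a).ne'
  have hsum : tangentBarrier x y - shiftedBarrier 0 y
      = 1 - 2 * ∑ a, (T a - 1 - Real.log (T a)) := by
    have hcard : (2 * (d + 1) : ℝ) = ∑ _a : Option (Fin d), 2 := by
      rw [Finset.sum_const, Finset.card_univ, Fintype.card_option, Fintype.card_fin,
        nsmul_eq_mul]
      push_cast
      ring
    simp only [tangentBarrier, shiftedBarrier, sub_zero, hcard, hlog, Finset.mul_sum]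
    rw [show ∀ p q r s : ℝ, p + 1 + q + r - s = 1 + (p + q + r - s) by intros; ring]
    rw [sub_eq_add_neg (1 : ℝ), ← Finset.sum_add_distrib, ← Finset.sum_add_distrib,
      ← Finset.sum_sub_distrib, ← Finset.sum_neg_distrib]
    congr 1
    refine Finset.sum_congr rfl fun b _ => ?_
    simp only [hT]
    ring
  have hterm : ∀ b, 0 ≤ T b - 1 - Real.log (T b) := fun b => by
    linarith [Real.log_le_sub_one_of_pos (hTp b)]
  have hle := Finset.single_le_sum (fun b _ => hterm b) (Finset.mem_univ a)
  have h1 : -((Real.log (d + 1) + 1) / 2 + 1) ≤ Real.log (T a) := by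
    linarith [hlow y hy, hTp a]
  have h2 := (Real.le_log_iff_exp_le (hTp a)).1 h1
  exact (le_div_iff₀ (hxp a)).1 h2

/-- The constant in Pogorelov's estimate. -/
def pogorelovBound (d : ℕ) (R : ℝ) : ℝ :=
  (d + (2 * (d + 1) * R + 2 * R / cutoffRatio d * incrementBound d))
    * Real.exp ((2 * R / cutoffRatio d * incrementBound d) ^ 2 / 2)

include hg hpos hup hlow in
lemma abs_dirDeriv_le_of_cutoffRatio_mul_le {x z e : Fin d → ℝ} {R : ℝ} (hR : 0 < R)
    (hz : z ∈ simplexΔ d) (he : ∀ a, |baryDir a e| ≤ R * baryCoord a x)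
    (hxz : ∀ a, cutoffRatio d * baryCoord a x ≤ baryCoord a z) :
    |dirDeriv e g z| ≤ 2 * R / cutoffRatio d * incrementBound d := by
  have hc := cutoffRatio_pos d
  have hs : 0 < cutoffRatio d / (2 * R) := by positivity
  have := abs_dirDeriv_le (v := (cutoffRatio d / (2 * R)) • e) hg hpos hup hlow hz fun a => by
    rw [baryDir_smul, abs_mul, abs_of_pos hs]
    calc cutoffRatio d / (2 * R) * |baryDir a e|
        ≤ cutoffRatio d / (2 * R) * (R * baryCoord a x) :=
          mul_le_mul_of_nonneg_left (he a) hs.le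
      _ = cutoffRatio d * baryCoord a x / 2 := by field_simp
      _ ≤ _ := by linarith [hxz a]
  have hd : dirDeriv ((cutoffRatio d / (2 * R)) • e) g z
      = cutoffRatio d / (2 * R) * dirDeriv e g z := by simp [dirDeriv]
  rw [hd, abs_mul, abs_of_pos hs] at this
  rw [div_mul_eq_mul_div, div_le_iff₀ (by positivity)] at this
  rw [div_mul_eq_mul_div, le_div_iff₀ hc]
  linarith

include hg hpos hup hlow in
lemma dirDeriv_dirDeriv_le_pogorelovBound {c : ℝ}
    (hdet : ∀ y ∈ simplexΔ d, (hess d g y).det = c * Real.exp (g y))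
    {x e : Fin d → ℝ} {R : ℝ} (hR : 0 < R)
    (hx : x ∈ simplexΔ d) (he0 : e ≠ 0) (he : ∀ a, |baryDir a e| ≤ R * baryCoord a x) :
    dirDeriv e (dirDeriv e g) x ≤ pogorelovBound d R := by
  have hΔ := isOpen_simplexΔ (d := d)
  have hxp := mem_simplexΔ_iff.1 hx
  have hc := cutoffRatio_pos d
  set K : Set (Fin d → ℝ) := {y | ∀ a, cutoffRatio d * baryCoord a x ≤ baryCoord a y} with hK
  have hKΔ : K ⊆ simplexΔ d := fun y hy =>
    mem_simplexΔ_iff.2 fun a => (mul_pos hc (hxp a)).trans_le (hy a)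
  have hxK : x ∈ K := fun a => mul_le_of_le_one_left (hxp a).le (cutoffRatio_le_one d)
  have hge := hg.dirDeriv hΔ e
  have hgee := hge.dirDeriv hΔ e
  set η : (Fin d → ℝ) → ℝ := fun y => tangentBarrier x y - g y with hηdef
  have hη : ContDiffOn ℝ (⊤ : ℕ∞) η (simplexΔ d) := (contDiff_tangentBarrier x).contDiffOn.sub hg
  have hEpos : ∀ y ∈ simplexΔ d, 0 < dirDeriv e (dirDeriv e g) y := fun y hy =>
    (hpos y hy).dirDeriv_dirDeriv_pos hΔ hg hy he0
  have hηx : 1 ≤ η x := by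
    simp only [hηdef, tangentBarrier_self hx]
    linarith [hup x hx]
  obtain ⟨z, hzK, hz⟩ := (isCompact_baryCoord_ge fun a => (mul_pos hc (hxp a)).le).exists_isMaxOn
    ⟨x, hxK⟩ (f := fun y => dirDeriv e (dirDeriv e g) y * max (η y) 0
      * Real.exp (dirDeriv e g y ^ 2 / 2)) (by
    refine ContinuousOn.mono ?_ hKΔ
    refine (hgee.continuousOn.mul (hη.continuousOn.sup continuousOn_const)).mul ?_
    exact Real.continuous_exp.comp_continuousOn ((hge.continuousOn.pow 2).div_const 2))
  have hzΔ := hKΔ hzK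
  have hzx := hz hxK
  simp only [Set.mem_ofPred_eq] at hzx
  have hEx : dirDeriv e (dirDeriv e g) x ≤ dirDeriv e (dirDeriv e g) x * max (η x) 0
      * Real.exp (dirDeriv e g x ^ 2 / 2) := by
    have h1 : 1 ≤ max (η x) 0 := hηx.trans (le_max_left _ _)
    have h2 : 1 ≤ Real.exp (dirDeriv e g x ^ 2 / 2) := Real.one_le_exp (by positivity)
    rw [mul_assoc]
    exact le_mul_of_one_le_right (hEpos x hx).le (one_le_mul_of_one_le_of_one_le h1 h2)
  have hηz : 0 < η z := by
    by_contra! hcon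
    rw [max_eq_right hcon, mul_zero, zero_mul] at hzx
    linarith [hEpos x hx]
  rw [max_eq_left hηz.le] at hzx
  set U : Set (Fin d → ℝ) := simplexΔ d ∩ η ⁻¹' Set.Ioi 0 with hU
  have hUo : IsOpen U := hη.continuousOn.isOpen_inter_preimage hΔ isOpen_Ioi
  have hUΔ : U ⊆ simplexΔ d := Set.inter_subset_left
  have hmax : IsLocalMax (fun y => Real.log (dirDeriv e (dirDeriv e g) y) + Real.log (η y)
      + dirDeriv e g y ^ 2 / 2) z := by
    have hlog : ∀ y ∈ U, Real.log (dirDeriv e (dirDeriv e g) y * max (η y) 0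
        * Real.exp (dirDeriv e g y ^ 2 / 2)) = Real.log (dirDeriv e (dirDeriv e g) y)
        + Real.log (η y) + dirDeriv e g y ^ 2 / 2 := by
      intro y hy
      have hy2 : 0 < η y := hy.2
      rw [max_eq_left hy2.le, Real.log_mul (mul_pos (hEpos y hy.1) hy2).ne' (Real.exp_ne_zero _),
        Real.log_exp, Real.log_mul (hEpos y hy.1).ne' hy2.ne']
    filter_upwards [hUo.mem_nhds ⟨hzΔ, hηz⟩] with y hy
    rw [← hlog y hy, ← hlog z ⟨hzΔ, hηz⟩]
    have hy2 : 0 < η y := hy.2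
    refine Real.log_le_log ?_ (hz (fun a => cutoffRatio_mul_le hlow hx hy.1 hy2 a))
    rw [max_eq_left hy2.le]
    exact mul_pos (mul_pos (hEpos y hy.1) hy2) (Real.exp_pos _)
  have hηe : dirDeriv e η z = ∑ a, -2 / baryCoord a x * baryDir a e - dirDeriv e g z := by
    have h := dirDeriv_add hΔ hη hg hzΔ e
    simp only [hηdef, sub_add_cancel] at h
    change dirDeriv e (tangentBarrier x) z = _ at h
    rw [dirDeriv_tangentBarrier] at h
    linarith
  have hηg : ∀ v, dirDeriv v (dirDeriv v η) z = -dirDeriv v (dirDeriv v g) z := by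
    intro v
    have h := dirDeriv_dirDeriv_add hΔ hη hg hzΔ v
    simp only [hηdef, sub_add_cancel] at h
    change dirDeriv v (dirDeriv v (tangentBarrier x)) z = _ at h
    rw [dirDeriv_tangentBarrier] at h
    have h0 : dirDeriv v (fun _ => ∑ a, -2 / baryCoord a x * baryDir a v) z = 0 := by
      simp [dirDeriv]
    rw [h0] at h
    linarith
  have hmain := dirDeriv_dirDeriv_le_of_isLocalMax hUo (hg.mono hUΔ)
    (fun y hy => hdet y hy.1) ⟨hzΔ, hηz⟩ (hpos z hzΔ) (hη.mono hUΔ) (fun y hy => hy.2) hηg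
    (fun y hy => hEpos y hy.1) hmax
  have hG := abs_dirDeriv_le_of_cutoffRatio_mul_le hg hpos hup hlow hR hzΔ he hzK
  set G := 2 * R / cutoffRatio d * incrementBound d with hGdef
  have hηeG : |dirDeriv e η z| ≤ 2 * (d + 1) * R + G := by
    rw [hηe]
    refine (abs_sub _ _).trans (add_le_add ?_ hG)
    refine (Finset.abs_sum_le_sum_abs _ _).trans ?_
    have : ∀ a ∈ Finset.univ, |-2 / baryCoord a x * baryDir a e| ≤ 2 * R := by
      intro a _
      rw [abs_mul, abs_div, abs_of_pos (hxp a), abs_neg, abs_two, div_mul_eq_mul_div,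
        div_le_iff₀ (hxp a)]
      linarith [he a]
    refine (Finset.sum_le_card_nsmul _ _ _ this).trans_eq ?_
    rw [Finset.card_univ, Fintype.card_option, Fintype.card_fin, nsmul_eq_mul]
    push_cast
    ring
  have hEη : dirDeriv e (dirDeriv e g) z * η z ≤ d + |dirDeriv e η z| := by
    have hE := hEpos z hzΔ
    set E := dirDeriv e (dirDeriv e g) z
    set q := dirDeriv e η z
    have hX : 0 < E * η z := mul_pos hE hηz
    have h1 : (E * η z) ^ 2 ≤ d * (E * η z) + |q| ^ 2 := by
      rw [sq_abs]
      calc (E * η z) ^ 2 = E * (E * η z ^ 2) := by ring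
        _ ≤ (d / η z + q ^ 2 / (E * η z ^ 2)) * (E * η z ^ 2) :=
          mul_le_mul_of_nonneg_right hmain (by positivity)
        _ = d * (E * η z) + q ^ 2 := by field_simp
    by_contra! hcon
    nlinarith [abs_nonneg q, mul_lt_mul_of_pos_right hcon hX, (Nat.cast_nonneg d : (0 : ℝ) ≤ d)]
  refine hEx.trans (hzx.trans ?_)
  unfold pogorelovBound
  refine mul_le_mul (hEη.trans (by linarith)) (Real.exp_le_exp.2 ?_) (Real.exp_pos _).le ?_
  · have := sq_le_sq' (neg_le_of_abs_le hG) (le_of_abs_le hG)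
    linarith
  · have := (abs_nonneg _).trans hηeG
    positivity

end SecondDerivativeBound

/-- Rescaled version of `Matrix.PosDef.two_sided_bound`. -/
lemma Matrix.PosDef.two_sided_bound_diagonal {n : Type*} [Fintype n] [DecidableEq n]
    {H : Matrix n n ℝ} (hH : H.PosDef) {s : n → ℝ} (hs : ∀ i, 0 < s i) {C c : ℝ}
    (hC : ∀ i, s i ^ 2 * H i i ≤ C) (hc : c ≤ (∏ i, s i ^ 2) * H.det)
    (hn : 0 < Fintype.card n) (hC0 : 0 < C) :
    (H - (c / (Fintype.card n * C) ^ (Fintype.card n - 1)) •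
      Matrix.diagonal (fun i => 1 / s i ^ 2)).PosSemidef ∧
    ((Fintype.card n * C) • Matrix.diagonal (fun i => 1 / s i ^ 2) - H).PosSemidef := by
  set D : Matrix n n ℝ := Matrix.diagonal s with hD
  set D' : Matrix n n ℝ := Matrix.diagonal (fun i => (s i)⁻¹) with hD'
  have hDD' : D * D' = 1 := by
    rw [hD, hD', Matrix.diagonal_mul_diagonal, ← Matrix.diagonal_one]
    congr 1
    funext i
    exact mul_inv_cancel₀ (hs i).ne'
  have hD'D : D' * D = 1 := mul_eq_one_comm.1 hDD'
  have hDH : Dᴴ = D := by simp [hD]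
  have hD'H : D'ᴴ = D' := by simp [hD']
  have hsq : D' * D' = Matrix.diagonal (fun i => 1 / s i ^ 2) := by
    rw [hD', Matrix.diagonal_mul_diagonal]
    congr 1
    funext i
    rw [one_div, sq, mul_inv]
  have hinj : Function.Injective D.vecMul :=
    Matrix.vecMul_injective_iff_isUnit.2 (IsUnit.of_mul_eq_one _ hDD')
  have hpd : (D * H * D).PosDef := by
    simpa only [hDH] using hH.mul_mul_conjTranspose_same hinj
  have hback : D' * (D * H * D) * D' = H := by
    calc D' * (D * H * D) * D' = (D' * D) * H * (D * D') := by simp only [Matrix.mul_assoc]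
      _ = H := by rw [hD'D, hDD', Matrix.one_mul, Matrix.mul_one]
  obtain ⟨h1, h2⟩ := hpd.two_sided_bound (C := C) (c := c)
    (fun i => by
      have := hC i
      simp only [hD, Matrix.mul_diagonal, Matrix.diagonal_mul]
      linarith)
    (by
      rw [Matrix.det_mul, Matrix.det_mul, hD, Matrix.det_diagonal]
      rw [Finset.prod_pow] at hc
      linarith) hn hC0
  constructor
  · have := h1.mul_mul_conjTranspose_same D'
    rwa [hD'H, Matrix.mul_sub, Matrix.sub_mul, hback, Matrix.mul_smul, Matrix.smul_mul,
      Matrix.mul_one, hsq] at this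
  · have := h2.mul_mul_conjTranspose_same D'
    rwa [hD'H, Matrix.mul_sub, Matrix.sub_mul, hback, Matrix.mul_smul, Matrix.smul_mul,
      Matrix.mul_one, hsq] at this

/-- Two-sided Loewner bounds on the Hessian of the Monge–Ampère solution near a
boundary face where the first `k` coordinates vanish. -/
theorem hessian_boundary_asymptotics (d k : ℕ) (hd : 1 ≤ d)
    (hk₁ : 1 ≤ k) (hkd : k ≤ d) (g : (Fin d → ℝ) → ℝ)
    (hg : ContDiffOn ℝ (⊤ : ℕ∞) g (simplexΔ d))
    (hpos : ∀ x ∈ simplexΔ d, (hess d g x).PosDef)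
    (hMA : ∀ x ∈ simplexΔ d, g x = Real.log (((2 : ℝ)⁻¹ • hess d g x).det))
    (hbd : ∀ x0 ∈ frontier (simplexΔ d),
      Filter.Tendsto g (nhdsWithin x0 (simplexΔ d)) Filter.atTop)
    (x0 : Fin d → ℝ)
    (hzero : ∀ i : Fin d, (i : ℕ) < k → x0 i = 0)
    (hpos' : ∀ i : Fin d, k ≤ (i : ℕ) → 0 < x0 i)
    (hsum : (∑ i ∈ Finset.univ.filter (fun i : Fin d => k ≤ (i : ℕ)), x0 i) < 1) :
    ∃ c₁ > (0 : ℝ), ∃ c₂ > (0 : ℝ), ∀ x : Fin d → ℝ,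
      (∀ i : Fin d, (i : ℕ) < k → 0 < x i ∧
        x i < (1 - ∑ j ∈ Finset.univ.filter (fun j : Fin d => k ≤ (j : ℕ)), x0 j)
                / (2 * d)) →
      (hess d g (fun i => if (i : ℕ) < k then x i else x0 i)
          - c₁ • Matrix.diagonal (fun i : Fin d =>
              if (i : ℕ) < k then 1 / x i ^ 2 else 1)).PosSemidef ∧
      (c₂ • Matrix.diagonal (fun i : Fin d =>
              if (i : ℕ) < k then 1 / x i ^ 2 else 1)
          - hess d g (fun i => if (i : ℕ) < k then x i else x0 i)).PosSemidef := by

  have hdet2 : ∀ y ∈ simplexΔ d, ((2 : ℝ)⁻¹ • hess d g y).det = Real.exp (g y) := fun y hy => by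
    rw [hMA y hy, Real.exp_log ((hpos y hy).smul (by norm_num)).det_pos]
  have hdet : ∀ y ∈ simplexΔ d, (hess d g y).det = 2 ^ d * Real.exp (g y) := fun y hy => by
    rw [← hdet2 y hy, Matrix.det_smul, Fintype.card_fin, ← mul_assoc, ← mul_pow]
    norm_num
  have hup : ∀ y ∈ simplexΔ d, g y ≤ shiftedBarrier 0 y := fun y hy =>
    le_shiftedBarrier_zero hg hpos hdet2 hy
  have hlow : ∀ y ∈ simplexΔ d, shiftedBarrier 0 y ≤ g y + Real.log (d + 1) := fun y hy =>
    shiftedBarrier_zero_le hg hdet2 hbd hy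
  have hd0 : (0 : ℝ) < d := Nat.cast_pos.2 hd
  set S := ∑ j ∈ Finset.univ.filter (fun j : Fin d => k ≤ (j : ℕ)), x0 j with hS
  have hS0 : 0 ≤ S := Finset.sum_nonneg fun i hi => (hpos' i (Finset.mem_filter.1 hi).2).le
  set R := 2 / (1 - S) with hRdef
  have hR : 1 ≤ R := (one_le_div (by linarith)).2 (by linarith)
  set M : ℝ := 1 + ∑ i, (x0 i ^ 2)⁻¹ with hM
  have hM1 : 1 ≤ M := le_add_of_nonneg_right (Finset.sum_nonneg fun i _ => by positivity)
  set C : ℝ := max (pogorelovBound d R) 1 with hCdef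
  have hC : 0 < C := one_pos.trans_le (le_max_right _ _)
  have hn : 0 < Fintype.card (Fin d) := by rw [Fintype.card_fin]; exact hd
  have hn' : (0 : ℝ) < Fintype.card (Fin d) := Nat.cast_pos.2 hn
  refine ⟨(d + 1 : ℝ)⁻¹ / (Fintype.card (Fin d) * (M * C)) ^ (Fintype.card (Fin d) - 1),
    by positivity, Fintype.card (Fin d) * (M * C), by positivity, fun x hx => ?_⟩
  set y : Fin d → ℝ := fun i => if (i : ℕ) < k then x i else x0 i with hy
  set s : Fin d → ℝ := fun i => if (i : ℕ) < k then x i else 1 with hs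
  have hy0 : ∀ i, 0 < y i := fun i => by
    by_cases hi : (i : ℕ) < k
    · simpa [hy, hi] using (hx i hi).1
    · simpa [hy, hi] using hpos' i (not_lt.1 hi)
  have hs0 : ∀ i, 0 < s i := fun i => by
    by_cases hi : (i : ℕ) < k
    · simpa [hs, hi] using (hx i hi).1
    · simp [hs, hi]
  have hysum : ∑ i, y i ≤ (1 - S) / 2 + S := by
    have h1 : ∀ i ∈ Finset.univ, y i ≤ (1 - S) / (2 * d) + if k ≤ (i : ℕ) then x0 i else 0 := by
      intro i _
      by_cases hi : (i : ℕ) < k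
      · simpa [hy, hi, not_le.2 hi] using (hx i hi).2.le
      · have : 0 ≤ (1 - S) / (2 * d) := div_nonneg (by linarith) (by linarith)
        simpa [hy, hi, not_lt.1 hi] using this
    refine (Finset.sum_le_sum h1).trans_eq ?_
    rw [Finset.sum_add_distrib, ← Finset.sum_filter, Finset.sum_const, Finset.card_univ,
      Fintype.card_fin, nsmul_eq_mul, ← hS]
    field_simp
  have hnone : (1 - S) / 2 ≤ baryCoord none y := by
    rw [baryCoord_none]
    linarith
  have hyΔ : y ∈ simplexΔ d := mem_simplexΔ_iff.2 <| Option.forall.2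
    ⟨lt_of_lt_of_le (by linarith) hnone, hy0⟩
  have hy1 : ∀ a, baryCoord a y ≤ 1 := baryCoord_le_one fun a => (mem_simplexΔ_iff.1 hyΔ a).le
  have hys : ∀ i, y i ≤ s i := fun i => by
    by_cases hi : (i : ℕ) < k
    · simp [hy, hs, hi]
    · simpa [hs, hi] using hy1 (some i)
  have hsM : ∀ i, s i ^ 2 ≤ M * y i ^ 2 := fun i => by
    by_cases hi : (i : ℕ) < k
    · have : s i = y i := by simp [hy, hs, hi]
      rw [this]
      exact le_mul_of_one_le_left (by positivity) hM1
    · have h0 := pow_pos (hpos' i (not_lt.1 hi)) 2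
      have h1 : (x0 i ^ 2)⁻¹ ≤ M := by
        have := Finset.single_le_sum (f := fun i => (x0 i ^ 2)⁻¹)
          (fun j _ => by positivity) (Finset.mem_univ i)
        linarith
      simpa [hy, hs, hi] using (inv_le_iff_one_le_mul₀ h0).1 h1
  have hdiag : ∀ i, y i ^ 2 * hess d g y i i ≤ C := by
    intro i
    have hbound := dirDeriv_dirDeriv_le_pogorelovBound hg hpos hup hlow hdet
      (one_pos.trans_le hR) hyΔ (e := Pi.single i (y i)) (by simpa using (hy0 i).ne') ?_
    · rw [dirDeriv_dirDeriv_eq_sum_hess isOpen_simplexΔ hg hyΔ,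
        Finset.sum_eq_single i (fun j _ hj => by simp [hj]) (by simp),
        Finset.sum_eq_single i (fun j _ hj => by simp [hj]) (by simp)] at hbound
      simp only [Pi.single_eq_same] at hbound
      have := le_max_left (pogorelovBound d R) 1
      linarith
    · refine Option.forall.2 ⟨?_, fun j => ?_⟩
      · have h1 : 1 ≤ R * baryCoord none y := by
          have := mul_le_mul_of_nonneg_left hnone (zero_le_one.trans hR)
          refine le_trans (le_of_eq ?_) this
          rw [hRdef]
          have : 1 - S ≠ 0 := by linarith
          field_simp
        have h2 : |baryDir none (Pi.single i (y i))| = y i := by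
          simp [abs_of_pos (hy0 i)]
        rw [h2]
        exact (hy1 (some i)).trans h1
      · by_cases hij : j = i
        · subst hij
          simpa [abs_of_pos (hy0 j)] using le_mul_of_one_le_left (hy0 j).le hR
        · simpa [hij] using mul_nonneg (zero_le_one.trans hR) (hy0 j).le
  have hdetlow : (d + 1 : ℝ)⁻¹ ≤ (∏ i, s i ^ 2) * (hess d g y).det := by
    have h1 : (∏ i, s i ^ 2)⁻¹ ≤ Real.exp (shiftedBarrier 0 y) := by
      rw [exp_shiftedBarrier (mem_simplexΔ_iff.1 hyΔ), Fintype.prod_option,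
        ← Finset.prod_inv_distrib]
      have h2 : 1 ≤ ((baryCoord none y - 0) ^ 2)⁻¹ := by
        rw [sub_zero]
        exact (one_le_inv₀ (pow_pos (mem_simplexΔ_iff.1 hyΔ none) 2)).2
          (pow_le_one₀ (mem_simplexΔ_iff.1 hyΔ none).le (hy1 none))
      have h3 : ∏ i, (s i ^ 2)⁻¹ ≤ ∏ i, ((baryCoord (some i) y - 0) ^ 2)⁻¹ := by
        refine Finset.prod_le_prod (fun i _ => by positivity) fun i _ => ?_
        rw [sub_zero]
        exact inv_anti₀ (pow_pos (hy0 i) 2) (pow_le_pow_left₀ (hy0 i).le (hys i) 2)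
      exact h3.trans (le_mul_of_one_le_left (by positivity) h2)
    have h2 : Real.exp (shiftedBarrier 0 y) ≤ Real.exp (g y) * (d + 1) := by
      rw [← Real.exp_log (show (0 : ℝ) < d + 1 by positivity), ← Real.exp_add]
      exact Real.exp_le_exp.2 (hlow y hyΔ)
    have h3 : Real.exp (g y) ≤ (hess d g y).det := by
      rw [hdet y hyΔ]
      exact le_mul_of_one_le_left (Real.exp_pos _).le (one_le_pow₀ one_le_two)
    have hprod : 0 < ∏ i, s i ^ 2 := Finset.prod_pos fun i _ => pow_pos (hs0 i) 2
    rw [inv_le_iff_one_le_mul₀ (by positivity), mul_assoc]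
    rw [inv_le_iff_one_le_mul₀ hprod] at h1
    rw [mul_comm] at h1
    refine h1.trans (mul_le_mul_of_nonneg_left (h2.trans ?_) hprod.le)
    exact mul_le_mul_of_nonneg_right h3 (by positivity)
  have hweights : (fun i : Fin d => if (i : ℕ) < k then 1 / x i ^ 2 else 1)
      = fun i => 1 / s i ^ 2 := by
    funext i
    by_cases hi : (i : ℕ) < k <;> simp [hs, hi]
  rw [hweights]
  refine (hpos y hyΔ).two_sided_bound_diagonal hs0 (fun i => ?_) hdetlow hn (by positivity)
  have hii : 0 < hess d g y i i := (hpos y hyΔ).diag_pos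
  calc s i ^ 2 * hess d g y i i ≤ M * y i ^ 2 * hess d g y i i :=
        mul_le_mul_of_nonneg_right (hsM i) hii.le
    _ = M * (y i ^ 2 * hess d g y i i) := by ring
    _ ≤ M * C := mul_le_mul_of_nonneg_left (hdiag i) (by linarith)
end
end

section
/- In dimension d = 1, the function g(x) := log(π²/sin²(πx)) is smooth on (0,1), satisfies g''(x) = 2π²/sin²(πx) > 0, solves the one-dimensional Monge–Ampère equation g(x) = log(½ g''(x)) for every x ∈ (0,1), and satisfies g(x) → +∞ as x → 0⁺ and as x → 1⁻. -/
open Real Filter MeasureTheory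
open scoped Matrix

noncomputable section

theorem sin_pi_mul_pos_of_mem_Ioo {x : ℝ} (hx : x ∈ Set.Ioo (0 : ℝ) 1) :
    0 < Real.sin (π * x) :=
  Real.sin_pos_of_pos_of_lt_pi (mul_pos pi_pos hx.1) (by nlinarith [hx.2, pi_pos])

theorem hasDerivAt_log_sq_div_sin_sq {x : ℝ} (hx : Real.sin (π * x) ≠ 0) :
    HasDerivAt (fun x : ℝ => Real.log (π ^ 2 / Real.sin (π * x) ^ 2))
      (-2 * π * Real.cos (π * x) / Real.sin (π * x)) x := by
  have hs : HasDerivAt (fun x : ℝ => Real.sin (π * x)) (Real.cos (π * x) * π) x := by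
    simpa using ((hasDerivAt_id x).const_mul π).sin
  have hπ : π ≠ 0 := pi_ne_zero
  convert (((hasDerivAt_const x (π ^ 2)).fun_div (hs.fun_pow 2) (pow_ne_zero 2 hx)).log
    (div_ne_zero (pow_ne_zero 2 hπ) (pow_ne_zero 2 hx))) using 1
  field_simp
  ring

theorem hasDerivAt_cos_div_sin_pi_mul {x : ℝ} (hx : Real.sin (π * x) ≠ 0) :
    HasDerivAt (fun x : ℝ => -2 * π * Real.cos (π * x) / Real.sin (π * x))
      (2 * π ^ 2 / Real.sin (π * x) ^ 2) x := by
  have hs : HasDerivAt (fun x : ℝ => Real.sin (π * x)) (Real.cos (π * x) * π) x := by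
    simpa using ((hasDerivAt_id x).const_mul π).sin
  have hc : HasDerivAt (fun x : ℝ => Real.cos (π * x)) (-Real.sin (π * x) * π) x := by
    simpa using ((hasDerivAt_id x).const_mul π).cos
  refine ((hc.const_mul (-2 * π)).fun_div hs hx).congr_deriv ?_
  congr 1
  linear_combination 2 * π ^ 2 * Real.sin_sq_add_cos_sq (π * x)

theorem deriv_deriv_log_sq_div_sin_sq {x : ℝ} (hx : x ∈ Set.Ioo (0 : ℝ) 1) :
    deriv (deriv (fun x : ℝ => Real.log (π ^ 2 / Real.sin (π * x) ^ 2))) x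
      = 2 * π ^ 2 / Real.sin (π * x) ^ 2 := by
  have h : deriv (fun x : ℝ => Real.log (π ^ 2 / Real.sin (π * x) ^ 2)) =ᶠ[nhds x]
      fun x : ℝ => -2 * π * Real.cos (π * x) / Real.sin (π * x) := by
    filter_upwards [isOpen_Ioo.mem_nhds hx] with y hy
    exact (hasDerivAt_log_sq_div_sin_sq (sin_pi_mul_pos_of_mem_Ioo hy).ne').deriv
  rw [h.deriv_eq]
  exact (hasDerivAt_cos_div_sin_pi_mul (sin_pi_mul_pos_of_mem_Ioo hx).ne').deriv

theorem tendsto_log_sq_div_sin_sq_atTop {a : ℝ} (ha : Real.sin (π * a) = 0) :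
    Tendsto (fun x : ℝ => Real.log (π ^ 2 / Real.sin (π * x) ^ 2))
      (nhdsWithin a (Set.Ioo 0 1)) atTop := by
  refine Real.tendsto_log_atTop.comp ?_
  simp only [div_eq_mul_inv]
  refine Tendsto.const_mul_atTop (by positivity) (tendsto_inv_nhdsGT_zero.comp ?_)
  refine tendsto_nhdsWithin_iff.2 ⟨?_, ?_⟩
  · have hc : Continuous fun x : ℝ => Real.sin (π * x) ^ 2 := by fun_prop
    simpa [ha] using (hc.tendsto a).mono_left nhdsWithin_le_nhds
  · filter_upwards [self_mem_nhdsWithin] with x hx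
    exact pow_pos (sin_pi_mul_pos_of_mem_Ioo hx) 2

/-- The one-dimensional Monge–Ampère solution `g(x) = log(π²/sin²(πx))`. -/
theorem one_dim_MA_solution :
    ContDiffOn ℝ (⊤ : ℕ∞)
      (fun x : ℝ => Real.log (π ^ 2 / Real.sin (π * x) ^ 2)) (Set.Ioo 0 1) ∧
    (∀ x ∈ Set.Ioo (0 : ℝ) 1,
      deriv (deriv (fun x : ℝ => Real.log (π ^ 2 / Real.sin (π * x) ^ 2))) x
          = 2 * π ^ 2 / Real.sin (π * x) ^ 2 ∧
      0 < 2 * π ^ 2 / Real.sin (π * x) ^ 2 ∧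
      Real.log (π ^ 2 / Real.sin (π * x) ^ 2)
          = Real.log ((2 : ℝ)⁻¹ *
              deriv (deriv (fun x : ℝ => Real.log (π ^ 2 / Real.sin (π * x) ^ 2))) x)) ∧
    Filter.Tendsto (fun x : ℝ => Real.log (π ^ 2 / Real.sin (π * x) ^ 2))
      (nhdsWithin 0 (Set.Ioo 0 1)) Filter.atTop ∧
    Filter.Tendsto (fun x : ℝ => Real.log (π ^ 2 / Real.sin (π * x) ^ 2))
      (nhdsWithin 1 (Set.Ioo 0 1)) Filter.atTop := by
  refine ⟨fun x hx => ?_, fun x hx => ?_, tendsto_log_sq_div_sin_sq_atTop (by simp),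
    tendsto_log_sq_div_sin_sq_atTop (by simp)⟩
  · have hs := sin_pi_mul_pos_of_mem_Ioo hx
    have hsin : ContDiffAt ℝ (⊤ : ℕ∞) (fun x : ℝ => Real.sin (π * x)) x :=
      (contDiff_const.mul contDiff_id).sin.contDiffAt
    exact ((contDiffAt_const.div (hsin.pow 2) (pow_ne_zero 2 hs.ne')).log
      (div_ne_zero (pow_ne_zero 2 pi_ne_zero) (pow_ne_zero 2 hs.ne'))).contDiffWithinAt
  · have hs := sin_pi_mul_pos_of_mem_Ioo hx
    refine ⟨deriv_deriv_log_sq_div_sin_sq hx, by positivity, ?_⟩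
    rw [deriv_deriv_log_sq_div_sin_sq hx]
    congr 1
    ring
end
end

section
/- If g is a C^∞ function on Δ with everywhere positive definite Hessian satisfying g(x) = log det(½∇²g(x)) for all x ∈ Δ, then the function v(t,x) := (1−t)·g(x) + d(1−t)·log(1−t), defined for (t,x) ∈ [0,1) × Δ, solves the Hamilton–Jacobi–Bellman equation −∂_t v(t,x) = log det(½∇²_x v(t,x)) + d for all (t,x) ∈ [0,1) × Δ, and moreover v(t,x) → 0 as t → 1⁻ for every fixed x ∈ Δ. -/
open Real Filter MeasureTheory
open scoped Matrix

noncomputable section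

/-- The Hessian is unchanged by adding a constant and scales with the function. -/
theorem hess_const_mul_add_const (d : ℕ) (u : (Fin d → ℝ) → ℝ) (c k : ℝ) (x : Fin d → ℝ) :
    hess d (fun y => c * u y + k) x = c • hess d u x := by
  ext i j
  have h : ∀ (f : (Fin d → ℝ) → ℝ) (y : Fin d → ℝ),
      fderiv ℝ (fun z => c * f z) y = c • fderiv ℝ f y := fun f y =>
    congrFun (fderiv_const_smul_field (𝕜 := ℝ) (f := f) c) y
  simp only [hess, Matrix.of_apply, Matrix.smul_apply, fderiv_add_const, h,
    _root_.smul_apply, smul_eq_mul]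

/-- `v(t,x) = (1-t)g(x) + d(1-t)log(1-t)` solves the HJB equation
`-∂ₜv = log det(½∇²ₓv) + d` and vanishes as `t → 1⁻`. -/
theorem MA_solution_solves_HJB (d : ℕ) (hd : 1 ≤ d)
    (g : (Fin d → ℝ) → ℝ)
    (hg : ContDiffOn ℝ (⊤ : ℕ∞) g (simplexΔ d))
    (hpos : ∀ x ∈ simplexΔ d, (hess d g x).PosDef)
    (hMA : ∀ x ∈ simplexΔ d, g x = Real.log (((2 : ℝ)⁻¹ • hess d g x).det)) :
    (∀ t ∈ Set.Ico (0 : ℝ) 1, ∀ x ∈ simplexΔ d,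
      -(deriv (fun s : ℝ => (1 - s) * g x + (d : ℝ) * (1 - s) * Real.log (1 - s)) t)
        = Real.log (((2 : ℝ)⁻¹ •
            hess d (fun y => (1 - t) * g y + (d : ℝ) * (1 - t) * Real.log (1 - t)) x).det)
          + d) ∧
    (∀ x ∈ simplexΔ d,
      Filter.Tendsto
        (fun t : ℝ => (1 - t) * g x + (d : ℝ) * (1 - t) * Real.log (1 - t))
        (nhdsWithin 1 (Set.Iio 1)) (nhds 0)) := by
  refine ⟨fun t ht x hx => ?_, fun x _ => ?_⟩
  · have h1 : 0 < 1 - t := sub_pos.2 ht.2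
    have hdet : ((2 : ℝ)⁻¹ • hess d g x).det ≠ 0 := by
      rw [Matrix.det_smul]
      exact mul_ne_zero (by positivity) (hpos x hx).det_pos.ne'
    rw [hess_const_mul_add_const, smul_comm, Matrix.det_smul, Fintype.card_fin,
      Real.log_mul (pow_ne_zero _ h1.ne') hdet, Real.log_pow, ← hMA x hx]
    have hs : HasDerivAt (fun s : ℝ => 1 - s) (-1) t := (hasDerivAt_id t).const_sub 1
    have hv := (hs.mul_const (g x)).add ((hs.const_mul (d : ℝ)).mul (hs.log h1.ne'))
    have hv' : deriv (fun s : ℝ => (1 - s) * g x + (d : ℝ) * (1 - s) * Real.log (1 - s)) t = _ :=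
      hv.deriv
    rw [hv']
    field_simp
    ring
  · have hc : Continuous fun t : ℝ => (1 - t) * g x + (d : ℝ) * ((1 - t) * Real.log (1 - t)) :=
      ((continuous_const.sub continuous_id).mul continuous_const).add
        (continuous_const.mul
          (Real.continuous_mul_log.comp (continuous_const.sub continuous_id)))
    have h := (hc.tendsto 1).mono_left (nhdsWithin_le_nhds (s := Set.Iio 1))
    simpa [mul_assoc] using h
end
end
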